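/- arXiv:2407.10556 — 5 statements merged into one kernel-verified Lean document; each statement's English description precedes it below -/
import Mathlib

section
/- Let G be a finite connected simple graph of order n, equator q, odd girth g = 2k+1 and minimum degree δ. If q > 6k + 3, then g·n ≥ q·M(δ, g), i.e. n ≥ (q/g)·M(δ, g). -/
open SimpleGraph

/-- The distance between two indices around a cycle of length `q`. -/
def cycleDist {q : ℕ} (i j : ZMod q) : ℕ := min (i - j).val (j - i).val

/-- `f` lists the vertices (in cyclic order) of an isometric cycle of length `q` in `G`:
the distance in `G` between any two of its vertices equals their distance along the cycle. -/
def IsIsoCycle {V : Type*} (G : SimpleGraph V) (q : ℕ) (f : ZMod q → V) : Prop :=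
  3 ≤ q ∧ ∀ i j : ZMod q, G.dist (f i) (f j) = cycleDist i j

/-- `G` has an isometric cycle of length `q`. -/
def HasIsoCycle {V : Type*} (G : SimpleGraph V) (q : ℕ) : Prop :=
  ∃ f : ZMod q → V, IsIsoCycle G q f

/-- The equator of `G` is `q`: `q` is the length of a longest isometric cycle of `G`
(`0` if `G` has no isometric cycle, e.g. if `G` is acyclic). -/
def IsEquator {V : Type*} (G : SimpleGraph V) (q : ℕ) : Prop :=
  (HasIsoCycle G q ∨ (q = 0 ∧ ∀ q', ¬ HasIsoCycle G q')) ∧ ∀ q', HasIsoCycle G q' → q' ≤ q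

/-- The degree of a vertex, as the cardinality of its neighbor set. -/
noncomputable def ndeg {V : Type*} (G : SimpleGraph V) (v : V) : ℕ := (G.neighborSet v).ncard

/-- `G` has minimum degree `δ`. -/
def HasMinDegree {V : Type*} (G : SimpleGraph V) (δ : ℕ) : Prop :=
  (∀ v, δ ≤ ndeg G v) ∧ ∃ v, ndeg G v = δ

/-- The Moore bound `M(δ, g)`. -/
def mooreBound (δ g : ℕ) : ℕ :=
  if Odd g then 1 + δ * ∑ i ∈ Finset.range ((g + 1) / 2 - 1), (δ - 1) ^ i
  else 2 + ∑ i ∈ Finset.Icc 1 ((g + 1) / 2 - 1), 2 * (δ - 1) ^ i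

/-- The disk of radius `k` around a vertex `u`. -/
def disk {V : Type*} (G : SimpleGraph V) (k : ℕ) (u : V) : Set V := {v | G.dist u v ≤ k}

/-- The disk of radius `k` around an edge `uv`. -/
def edisk {V : Type*} (G : SimpleGraph V) (k : ℕ) (u v : V) : Set V :=
  disk G k u ∪ disk G k v

/-- `G` is an equatorial graph with minimum degree `δ`, girth `g` and equator `q`:
a finite connected simple graph with girth `g`, minimum degree `δ`, equator `q > 6k + 3`
(where `k = ⌈g/2⌉ - 1`) whose order attains the bound `n = (q/g) · M(δ, g)`. -/
def IsEquatorial {V : Type*} (G : SimpleGraph V) (δ g q : ℕ) : Prop :=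
  Finite V ∧ G.Connected ∧ G.girth = g ∧ HasMinDegree G δ ∧ IsEquator G q ∧
    6 * ((g + 1) / 2 - 1) + 3 < q ∧ g * Nat.card V = q * mooreBound δ g

/-- The part `L i` of the partition induced by the isometric cycle `f`:
`L i = D_k(u_{i-k}) ∩ D_k(u_{i+k})`. -/
def Lpart {V : Type*} (G : SimpleGraph V) (k : ℕ) {q : ℕ} (f : ZMod q → V) (i : ZMod q) :
    Set V :=
  disk G k (f (i - (k : ZMod q))) ∩ disk G k (f (i + (k : ZMod q)))

namespace SimpleGraph

variable {V : Type*} {G : SimpleGraph V} {u v w : V}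

/-- Two paths with common endpoints whose total length is below the girth coincide. -/
theorem Walk.IsPath.eq_of_length_add_lt_girth {p p' : G.Walk u v} (hp : p.IsPath)
    (hp' : p'.IsPath) (h : p.length + p'.length < G.girth) : p = p' := by
  by_contra hne
  obtain ⟨x, -, -, c, hc, hle⟩ := hp.exists_isCycle_length_le_add_of_ne hp' hne
  have := girth_le_length hc
  omega

theorem Walk.isPath_concat_of_dist_le {p : G.Walk u v} (hp : p.length = G.dist u v)
    (hadj : G.Adj v w) (hle : G.dist u v ≤ G.dist u w) : (p.concat hadj).IsPath := by
  classical
  refine (p.isPath_of_length_eq_dist hp).concat (fun hw ↦ ?_) hadj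
  have h₁ := p.length_takeUntil_lt_length hw hadj.ne'
  have h₂ := dist_le (p.takeUntil w hw)
  omega

/-- Below half the girth, a vertex has at most one neighbour closer to a given root. -/
theorem Connected.eq_of_adj_of_dist_add_one {a b : V} (hG : G.Connected)
    (ha : G.Adj a v) (hb : G.Adj b v) (hda : G.dist u a + 1 = G.dist u v)
    (hdb : G.dist u b + 1 = G.dist u v) (hv : 2 * G.dist u v < G.girth) : a = b := by
  obtain ⟨p, -, hp⟩ := hG.exists_path_of_dist u a
  obtain ⟨p', -, hp'⟩ := hG.exists_path_of_dist u b
  have heq := (p.isPath_concat_of_dist_le hp ha (by omega)).eq_of_length_add_lt_girth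
    (p'.isPath_concat_of_dist_le hp' hb (by omega)) (by simp only [Walk.length_concat]; omega)
  exact (Walk.concat_inj heq).1

/-- Below half the girth, adjacent vertices lie on different spheres around a given root. -/
theorem Connected.dist_ne_of_adj_of_lt_girth (hG : G.Connected) (hadj : G.Adj v w)
    (hv : 2 * G.dist u v + 1 < G.girth) : G.dist u w ≠ G.dist u v := by
  intro hd
  obtain ⟨p, -, hp⟩ := hG.exists_path_of_dist u v
  obtain ⟨p', hpath, hp'⟩ := hG.exists_path_of_dist u w
  have heq := (p.isPath_concat_of_dist_le hp hadj hd.ge).eq_of_length_add_lt_girth hpath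
    (by simp only [Walk.length_concat]; omega)
  have := congrArg Walk.length heq
  simp only [Walk.length_concat] at this
  omega

open scoped Classical in
theorem Connected.card_sphere_mul_le [Fintype V] (hG : G.Connected) {δ i : ℕ}
    (hδ : ∀ v, δ ≤ ndeg G v) (hi : 2 * (i + 1) < G.girth) (hi₀ : 0 < i) (u : V) :
    (Finset.univ.filter fun v ↦ G.dist u v = i).card * (δ - 1) ≤
      (Finset.univ.filter fun v ↦ G.dist u v = i + 1).card := by
  refine (Finset.card_mul_le_card_mul (n := 1) G.Adj (fun v hv ↦ ?_) fun v hv ↦ ?_).trans_eq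
    (mul_one _)
  · simp only [Finset.mem_filter, Finset.mem_univ, true_and] at hv
    have hlow : ((G.neighborFinset v).filter fun w ↦ ¬ G.dist u w = i + 1).card ≤ 1 := by
      refine Finset.card_le_one.2 fun a ha b hb ↦ ?_
      simp only [Finset.mem_filter, mem_neighborFinset] at ha hb
      have hdown : ∀ w, G.Adj v w → G.dist u w ≠ i + 1 → G.dist u w + 1 = G.dist u v := by
        intro w hw hne
        have h₁ := hG.dist_ne_of_adj_of_lt_girth (u := u) hw (by omega)
        have h₂ := hw.diff_dist_adj (u := u)
        omega
      exact hG.eq_of_adj_of_dist_add_one ha.1.symm hb.1.symm (hdown a ha.1 ha.2)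
        (hdown b hb.1 hb.2) (by omega)
    have hsplit := (G.neighborFinset v).card_filter_add_card_filter_not
      (fun w ↦ G.dist u w = i + 1)
    have hdeg : δ ≤ (G.neighborFinset v).card := by
      rw [← Set.ncard_coe_finset, coe_neighborFinset]
      exact hδ v
    have hsub : (G.neighborFinset v).filter (fun w ↦ G.dist u w = i + 1) =
        (Finset.univ.filter fun w ↦ G.dist u w = i + 1).bipartiteAbove G.Adj v := by
      ext w
      simp [Finset.bipartiteAbove, and_comm]
    rw [← hsub]
    omega
  · simp only [Finset.mem_filter, Finset.mem_univ, true_and] at hv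
    refine Finset.card_le_one.2 fun a ha b hb ↦ ?_
    simp only [Finset.bipartiteBelow, Finset.mem_filter, Finset.mem_univ, true_and] at ha hb
    exact hG.eq_of_adj_of_dist_add_one (u := u) ha.2 hb.2 (by omega) (by omega) (by omega)

open scoped Classical in
theorem Connected.le_card_sphere [Fintype V] (hG : G.Connected) {δ : ℕ}
    (hδ : ∀ v, δ ≤ ndeg G v) (u : V) (i : ℕ) (hi : 2 * (i + 1) < G.girth) :
    δ * (δ - 1) ^ i ≤ (Finset.univ.filter fun v ↦ G.dist u v = i + 1).card := by
  induction i with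
  | zero =>
    have h := hδ u
    rw [ndeg, ← coe_neighborFinset, Set.ncard_coe_finset] at h
    simpa [neighborFinset_eq_filter] using h
  | succ i ih =>
    calc δ * (δ - 1) ^ (i + 1) = δ * (δ - 1) ^ i * (δ - 1) := by ring
      _ ≤ _ := Nat.mul_le_mul_right _ (ih (by omega))
      _ ≤ _ := hG.card_sphere_mul_le hδ hi (by omega) u

open scoped Classical in
/-- The Moore bound for disks whose radius is below half the girth. -/
theorem Connected.mooreBound_le_card_disk [Fintype V] (hG : G.Connected) {δ k : ℕ}
    (hδ : ∀ v, δ ≤ ndeg G v) (hk : 2 * k < G.girth) (u : V) :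
    mooreBound δ (2 * k + 1) ≤ (Finset.univ.filter fun v ↦ G.dist u v ≤ k).card := by
  have hcard : (Finset.univ.filter fun v ↦ G.dist u v ≤ k).card =
      ∑ i ∈ Finset.range (k + 1), (Finset.univ.filter fun v ↦ G.dist u v = i).card := by
    rw [Finset.card_eq_sum_card_fiberwise (f := G.dist u) (t := Finset.range (k + 1))
      (fun v hv ↦ by simpa [Nat.lt_succ_iff] using hv)]
    refine Finset.sum_congr rfl fun i hi ↦ congrArg Finset.card ?_
    have := Finset.mem_range.1 hi
    ext v
    simp only [Finset.mem_filter, Finset.mem_univ, true_and]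
    omega
  have hroot : (Finset.univ.filter fun v ↦ G.dist u v = 0).card = 1 :=
    Finset.card_eq_one.2 ⟨u, by ext v; simp [hG.dist_eq_zero_iff, eq_comm]⟩
  rw [mooreBound, if_pos ⟨k, rfl⟩, show (2 * k + 1 + 1) / 2 - 1 = k by omega, hcard,
    Finset.sum_range_succ', hroot, add_comm, Finset.mul_sum]
  gcongr with i hi
  exact hG.le_card_sphere hδ u i (by have := Finset.mem_range.1 hi; omega)

end SimpleGraph

/-- A set of indices on a cycle of length `q > 3 * d` with pairwise distances at most `d` has at
most `d + 1` elements. -/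
theorem card_le_of_cycleDist_le {q d : ℕ} (hq : 3 * d < q) (s : Finset (ZMod q))
    (hs : ∀ i ∈ s, ∀ j ∈ s, cycleDist i j ≤ d) : s.card ≤ d + 1 := by
  have : NeZero q := ⟨by omega⟩
  obtain rfl | ⟨o, ho⟩ := s.eq_empty_or_nonempty
  · simp
  let φ : ZMod q → ℕ := fun i ↦ (i - o + (d : ZMod q)).val
  have hφ : Function.Injective φ := fun i j h ↦ by
    simpa using ZMod.val_injective q h
  have hφcast : ∀ i, (φ i : ZMod q) = i - o + (d : ZMod q) := fun i ↦ ZMod.natCast_rightInverse _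
  have hbound : ∀ i ∈ s, φ i ≤ 2 * d := by
    intro i hi
    obtain h | h := min_le_iff.1 (hs i hi o ho)
    · have heq : i - o + (d : ZMod q) = ((i - o).val + d : ℕ) := by
        push_cast
        rw [ZMod.natCast_rightInverse]
      simp only [φ]
      rw [heq, ZMod.val_natCast_of_lt (by omega)]
      omega
    · have heq : i - o + (d : ZMod q) = (d - (o - i).val : ℕ) := by
        rw [Nat.cast_sub h, ZMod.natCast_rightInverse]
        ring
      simp only [φ]
      rw [heq, ZMod.val_natCast_of_lt (by omega)]
      omega
  have hdiff : ∀ i ∈ s, ∀ j ∈ s, φ i ≤ φ j → φ j ≤ φ i + d := by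
    intro i hi j hj hij
    have hj₂ := hbound j hj
    have heq : j - i = (φ j - φ i : ℕ) := by
      rw [Nat.cast_sub hij, hφcast, hφcast]
      ring
    have hval : (j - i).val = φ j - φ i := by
      rw [heq, ZMod.val_natCast_of_lt (by omega)]
    obtain h | h := min_le_iff.1 (hs i hi j hj)
    · by_cases h₀ : φ j = φ i
      · omega
      · have hne : j - i ≠ 0 := fun h' ↦ by
          rw [h', ZMod.val_zero] at hval
          omega
        have : NeZero (j - i) := ⟨hne⟩
        have hneg : (i - j).val = q - (j - i).val := by
          rw [← neg_sub j i, ZMod.val_neg_of_ne_zero]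
        omega
    · omega
  obtain ⟨m, hm, hmin⟩ := s.exists_min_image φ ⟨o, ho⟩
  calc s.card ≤ (Finset.Icc (φ m) (φ m + d)).card :=
        Finset.card_le_card_of_injOn φ
          (fun i hi ↦ Finset.mem_coe.2 (Finset.mem_Icc.2
            ⟨hmin i hi, hdiff m hm i hi (hmin i hi)⟩)) hφ.injOn
    _ = d + 1 := by
        rw [Nat.card_Icc]
        omega

/-- Lemma 3.1: odd-girth lower bound `n ≥ (q/g)·M(δ,g)`. -/
theorem stmt_0 {V : Type*} [Fintype V] (G : SimpleGraph V) (G_conn : G.Connected)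
    (n q g k δ : ℕ) (hn : n = Nat.card V)
    (hg : G.girth = g) (hodd : g = 2 * k + 1)
    (hδ : HasMinDegree G δ)
    (hq : IsEquator G q) (hq' : 6 * k + 3 < q) :
    g * n ≥ q * mooreBound δ g := by
  classical
  subst hn hodd
  obtain ⟨⟨f, hq3, hf⟩ | ⟨rfl, -⟩, -⟩ := hq
  · have : NeZero q := ⟨by omega⟩
    have hcount := Finset.card_mul_le_card_mul (s := (Finset.univ : Finset (ZMod q)))
      (t := (Finset.univ : Finset V)) (m := mooreBound δ (2 * k + 1)) (n := 2 * k + 1)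
      (fun i v ↦ G.dist (f i) v ≤ k)
      (fun i _ ↦ G_conn.mooreBound_le_card_disk hδ.1 (by omega) (f i))
      (fun v _ ↦ card_le_of_cycleDist_le (by omega) _ fun i hi j hj ↦ by
        simp only [Finset.bipartiteBelow, Finset.mem_filter, Finset.mem_univ, true_and] at hi hj
        have htri := G_conn.dist_triangle (u := f i) (v := v) (w := f j)
        rw [G.dist_comm (u := v)] at htri
        rw [← hf]
        omega)
    rw [Finset.card_univ, ZMod.card, Finset.card_univ, ← Nat.card_eq_fintype_card] at hcount
    linarith
  · omega
end

section
/- Let G be a finite connected simple graph of order n, equator q, even girth g = 2k+2 and minimum degree δ. If q > 6k + 3, then g·n ≥ q·M(δ, g), i.e. n ≥ (q/g)·M(δ, g). -/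
open SimpleGraph

/-- Two distinct paths with the same ends have total length at least the girth. -/
theorem path_eq_of_length_add_lt_girth {V : Type*} {G : SimpleGraph V} {a b : V}
    {p r : G.Walk a b} (hp : p.IsPath) (hr : r.IsPath) (h : p.length + r.length < G.girth) :
    p = r := by
  classical
  set E : Finset (Sym2 V) := p.edges.toFinset ∪ r.edges.toFinset with hE
  set H : SimpleGraph V := G.deleteEdges {e | e ∉ E} with hH
  have mem_H : ∀ e ∈ G.edgeSet, e ∈ E → e ∈ H.edgeSet := fun e he heE => by
    rw [hH, edgeSet_deleteEdges]
    exact ⟨he, fun h => h heE⟩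
  have hpH : ∀ e ∈ p.edges, e ∈ H.edgeSet := fun e he =>
    mem_H e (p.edges_subset_edgeSet he) (by simp [hE, he])
  have hrH : ∀ e ∈ r.edges, e ∈ H.edgeSet := fun e he =>
    mem_H e (r.edges_subset_edgeSet he) (by simp [hE, he])
  have hle : H ≤ G := deleteEdges_le _
  have hacyc : H.IsAcyclic := by
    intro v c hc
    have hsub : c.edges.toFinset ⊆ E := fun e he => by
      have := c.edges_subset_edgeSet (List.mem_toFinset.1 he)
      rw [hH, edgeSet_deleteEdges] at this
      exact not_not.1 this.2
    have hlen : c.length ≤ p.length + r.length := by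
      calc c.length = c.edges.toFinset.card := by
            rw [List.toFinset_card_of_nodup hc.edges_nodup, Walk.length_edges]
        _ ≤ E.card := Finset.card_le_card hsub
        _ ≤ p.edges.toFinset.card + r.edges.toFinset.card := Finset.card_union_le _ _
        _ ≤ p.length + r.length := by
            rw [← p.length_edges, ← r.length_edges]
            exact add_le_add (List.toFinset_card_le _) (List.toFinset_card_le _)
    have hgirth := (hc.mapLe hle).girth_le_length
    rw [Walk.length_mapLe] at hgirth
    omega
  have huniq := (hacyc.subsingleton_path a b).elim ⟨p.transfer H hpH, hp.transfer hpH⟩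
    ⟨r.transfer H hrH, hr.transfer hrH⟩
  have hsupp : (p.transfer H hpH).support = (r.transfer H hrH).support :=
    congrArg (fun s : H.Path a b => s.1.support) huniq
  rw [Walk.support_transfer, Walk.support_transfer] at hsupp
  exact Walk.ext_support hsupp

/-- A neighbor `x` of `b` that is no farther from `a` than `b` is the penultimate vertex of a
path from `a` to `b` of length `G.dist a x + 1`. -/
theorem exists_path_penultimate {V : Type*} {G : SimpleGraph V} (hG : G.Connected) {a b x : V}
    (hx : G.Adj x b) (hd : G.dist a x ≤ G.dist a b) :
    ∃ p : G.Walk a b, p.IsPath ∧ p.length = G.dist a x + 1 ∧ p.penultimate = x := by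
  classical
  obtain ⟨p, hp, hlen⟩ := (hG a x).exists_path_of_dist
  have hb : b ∉ p.support := fun hb => by
    have h1 := dist_le (p.takeUntil b hb)
    have h2 := p.length_takeUntil_lt_length hb hx.ne'
    omega
  exact ⟨p.concat hx, hp.concat hb hx, by rw [Walk.length_concat, hlen],
    Walk.penultimate_concat p hx⟩

/-- Below the girth, the neighbor of `b` which is no farther from `a` than `b` is unique. -/
theorem predecessor_unique {V : Type*} {G : SimpleGraph V} (hG : G.Connected) {a b x y : V}
    (hx : G.Adj x b) (hy : G.Adj y b) (hdx : G.dist a x ≤ G.dist a b)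
    (hdy : G.dist a y ≤ G.dist a b) (h : G.dist a x + G.dist a y + 2 < G.girth) : x = y := by
  obtain ⟨p, hp, hpl, hpx⟩ := exists_path_penultimate hG hx hdx
  obtain ⟨r, hr, hrl, hry⟩ := exists_path_penultimate hG hy hdy
  rw [← hpx, ← hry, path_eq_of_length_add_lt_girth hp hr (by omega)]

/-- A vertex at distance `i + 1` from `a` has a neighbor at distance `i` from `a`. -/
theorem exists_adj_dist_eq {V : Type*} {G : SimpleGraph V} (hG : G.Connected) {a b : V} {i : ℕ}
    (h : G.dist a b = i + 1) : ∃ x, G.Adj x b ∧ G.dist a x = i := by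
  obtain ⟨p, -, hlen⟩ := (hG b a).exists_path_of_dist
  rw [SimpleGraph.dist_comm] at hlen
  cases p with
  | nil => rw [SimpleGraph.dist_self] at h; omega
  | @cons _ x _ hadj p =>
    refine ⟨x, hadj.symm, ?_⟩
    have h1 := dist_le p
    have h2 := hG.dist_triangle (u := a) (v := x) (w := b)
    rw [dist_eq_one_iff_adj.2 hadj.symm] at h2
    rw [Walk.length_cons] at hlen
    rw [SimpleGraph.dist_comm] at h1
    omega

section Layers

variable {V : Type*} [Fintype V]

open Classical in
/-- The vertices at distance `i` from `u` and `i + 1` from `w`. -/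
noncomputable def edgeLayer (G : SimpleGraph V) (u w : V) (i : ℕ) : Finset V :=
  {v | G.dist u v = i ∧ G.dist w v = i + 1}

theorem mem_edgeLayer {G : SimpleGraph V} {u w v : V} {i : ℕ} :
    v ∈ edgeLayer G u w i ↔ G.dist u v = i ∧ G.dist w v = i + 1 := by
  simp [edgeLayer]

/-- Each layer is at least `δ - 1` times as large as the preceding one. -/
theorem card_edgeLayer_mul_le {G : SimpleGraph V} (hG : G.Connected) {u w : V} {δ k i : ℕ}
    (huw : G.Adj u w) (hδ : ∀ v, δ ≤ ndeg G v) (hgirth : 2 * k + 1 < G.girth) (hi : i < k) :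
    (edgeLayer G u w i).card * (δ - 1) ≤ (edgeLayer G u w (i + 1)).card := by
  classical
  rw [← mul_one (edgeLayer G u w (i + 1)).card]
  have huw1 : G.dist w u = 1 := dist_eq_one_iff_adj.2 huw.symm
  refine Finset.card_mul_le_card_mul G.Adj (fun v hv => ?_) (fun x hx => ?_)
  · rw [mem_edgeLayer] at hv
    obtain ⟨x₀, hx₀, hdx₀⟩ := exists_adj_dist_eq hG hv.2
    have hsub : (G.neighborFinset v).erase x₀ ⊆
        Finset.bipartiteAbove G.Adj (edgeLayer G u w (i + 1)) v := by
      intro x hx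
      rw [Finset.mem_erase, mem_neighborFinset] at hx
      rw [Finset.mem_bipartiteAbove, mem_edgeLayer]
      have hvx : G.dist v x = 1 := dist_eq_one_iff_adj.2 hx.2
      have hlt : i + 1 < G.dist w x := by
        by_contra! hle
        exact hx.1 (predecessor_unique hG (a := w) hx.2.symm hx₀ (by omega) (by omega) (by omega))
      have h1 := hG.dist_triangle (u := u) (v := v) (w := x)
      have h2 := hG.dist_triangle (u := w) (v := u) (w := x)
      have h3 := hG.dist_triangle (u := w) (v := v) (w := x)
      exact ⟨by omega, hx.2⟩
    refine le_trans ?_ (Finset.card_le_card hsub)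
    refine le_trans ?_ Finset.pred_card_le_card_erase
    have hdeg := hδ v
    rw [ndeg, ← coe_neighborFinset, Set.ncard_coe_finset] at hdeg
    omega
  · rw [mem_edgeLayer] at hx
    refine Finset.card_le_one.2 fun v hv v' hv' => ?_
    rw [Finset.mem_bipartiteBelow, mem_edgeLayer] at hv hv'
    exact predecessor_unique hG (a := u) hv.2 hv'.2 (by omega) (by omega) (by omega)

theorem pow_le_card_edgeLayer {G : SimpleGraph V} (hG : G.Connected) {u w : V} {δ k : ℕ}
    (huw : G.Adj u w) (hδ : ∀ v, δ ≤ ndeg G v) (hgirth : 2 * k + 1 < G.girth) {i : ℕ}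
    (hi : i ≤ k) : (δ - 1) ^ i ≤ (edgeLayer G u w i).card := by
  induction i with
  | zero =>
    rw [pow_zero, Nat.one_le_iff_ne_zero, ← Nat.pos_iff_ne_zero, Finset.card_pos]
    exact ⟨u, mem_edgeLayer.2 ⟨dist_self, dist_eq_one_iff_adj.2 huw.symm⟩⟩
  | succ i ih =>
    rw [pow_succ]
    exact (Nat.mul_le_mul_right _ (ih (by omega))).trans
      (card_edgeLayer_mul_le hG huw hδ hgirth (by omega))

/-- The Moore bound for the disk around an edge in a graph of girth at least `2k + 2`. -/
theorem mooreBound_le_ncard_edisk {G : SimpleGraph V} (hG : G.Connected) {u w : V} {δ k : ℕ}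
    (huw : G.Adj u w) (hδ : ∀ v, δ ≤ ndeg G v) (hgirth : 2 * k + 1 < G.girth) :
    mooreBound δ (2 * k + 2) ≤ (edisk G k u w).ncard := by
  classical
  have hside : ∀ a b, G.Adj a b → ∑ i ∈ Finset.range (k + 1), (δ - 1) ^ i ≤
      ((Finset.range (k + 1)).biUnion (edgeLayer G a b)).card := by
    intro a b hab
    rw [Finset.card_biUnion]
    · exact Finset.sum_le_sum fun i hi =>
        pow_le_card_edgeLayer hG hab hδ hgirth (by simpa [Nat.lt_succ_iff] using hi)
    · intro i _ j _ hij
      refine Finset.disjoint_left.2 fun v hv hv' => hij ?_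
      rw [mem_edgeLayer] at hv hv'
      omega
  have hdisj : Disjoint ((Finset.range (k + 1)).biUnion (edgeLayer G u w))
      ((Finset.range (k + 1)).biUnion (edgeLayer G w u)) := by
    refine Finset.disjoint_left.2 fun v hv hv' => ?_
    simp only [Finset.mem_biUnion, mem_edgeLayer] at hv hv'
    obtain ⟨i, -, hi⟩ := hv
    obtain ⟨j, -, hj⟩ := hv'
    omega
  have hsub : (((Finset.range (k + 1)).biUnion (edgeLayer G u w) ∪
      (Finset.range (k + 1)).biUnion (edgeLayer G w u) : Finset V) : Set V) ⊆
      edisk G k u w := by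
    intro v hv
    simp only [Finset.coe_union, Set.mem_union, Finset.mem_coe, Finset.mem_biUnion,
      Finset.mem_range, mem_edgeLayer] at hv
    rcases hv with ⟨i, hi, h, -⟩ | ⟨i, hi, h, -⟩
    · exact Or.inl (show G.dist u v ≤ k by omega)
    · exact Or.inr (show G.dist w v ≤ k by omega)
  have hcard := Set.ncard_le_ncard hsub (Set.toFinite _)
  rw [Set.ncard_coe_finset, Finset.card_union_of_disjoint hdisj] at hcard
  have hmoore : mooreBound δ (2 * k + 2) = 2 * ∑ i ∈ Finset.range (k + 1), (δ - 1) ^ i := by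
    have hodd : ¬ Odd (2 * k + 2) := by
      rw [Nat.not_odd_iff_even]
      exact ⟨k + 1, by ring⟩
    have hk : (2 * k + 2 + 1) / 2 - 1 = k := by omega
    rw [mooreBound, if_neg hodd, hk, Finset.range_eq_Ico,
      Finset.sum_eq_sum_Ico_succ_bot (Nat.succ_pos k), ← Finset.mul_sum, pow_zero, mul_add, mul_one]
    rfl
  have h1 := hside u w huw
  have h2 := hside w u huw.symm
  omega

end Layers

/-- A set of indices of pairwise cyclic distance at most `m`, on a cycle of length more than
`3m`, lies in an arc of `m + 1` indices. -/
theorem exists_arc_of_cycleDist_le {q m : ℕ} (hq : 3 * m < q) {S : Set (ZMod q)}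
    (hS : S.Nonempty) (hdist : ∀ i ∈ S, ∀ j ∈ S, cycleDist i j ≤ m) :
    ∃ a, ∀ i ∈ S, (i - a).val ≤ m := by
  have : NeZero q := ⟨by omega⟩
  obtain ⟨s, hs⟩ := hS
  set t : ZMod q := s - (m : ZMod q) with ht
  have hcast : ∀ (x : ZMod q) (c : ℕ), c < q → x = (c : ZMod q) → x.val = c :=
    fun x c hc hx => by rw [hx, ZMod.val_natCast_of_lt hc]
  have hbound : ∀ i ∈ S, (i - t).val ≤ 2 * m := by
    intro i hi
    rcases min_le_iff.1 (hdist i hi s hs) with h | h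
    · have := hcast (i - t) (m + (i - s).val) (by omega) (by
        rw [Nat.cast_add, ZMod.natCast_zmod_val, ht]; ring)
      omega
    · have := hcast (i - t) (m - (s - i).val) (by omega) (by
        rw [Nat.cast_sub h, ZMod.natCast_zmod_val, ht]; ring)
      omega
  obtain ⟨a, ha, hmin⟩ := Set.exists_min_image S (fun i => (i - t).val) (Set.toFinite _) ⟨s, hs⟩
  refine ⟨a, fun i hi => ?_⟩
  have hia := hmin i hi
  have hi2 := hbound i hi
  have hval := hcast (i - a) ((i - t).val - (a - t).val) (by omega) (by
    rw [Nat.cast_sub hia, ZMod.natCast_zmod_val, ZMod.natCast_zmod_val]; ring)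
  rcases min_le_iff.1 (hdist i hi a ha) with h | h
  · exact h
  · have hneg : (i - a).val + (a - i).val = 0 ∨ q ≤ (i - a).val + (a - i).val := by
      by_contra! hlt
      have := hcast 0 ((i - a).val + (a - i).val) hlt.2 (by
        rw [Nat.cast_add, ZMod.natCast_zmod_val, ZMod.natCast_zmod_val]; ring)
      rw [ZMod.val_zero] at this
      exact hlt.1 this.symm
    omega

/-- A vertex lies in the `k`-disks of at most `2k + 2` edges of a long isometric cycle. -/
theorem ncard_setOf_mem_edisk_le {V : Type*} {G : SimpleGraph V} (hG : G.Connected) {q k : ℕ}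
    {f : ZMod q → V} (hf : IsIsoCycle G q f) (hq : 6 * k < q) (v : V) :
    {i : ZMod q | v ∈ edisk G k (f i) (f (i + 1))}.ncard ≤ 2 * k + 2 := by
  classical
  have : NeZero q := ⟨by omega⟩
  rcases Set.eq_empty_or_nonempty {i : ZMod q | v ∈ disk G k (f i)} with hS | hS
  · have hempty : {i : ZMod q | v ∈ edisk G k (f i) (f (i + 1))} = ∅ := by
      refine Set.eq_empty_of_forall_notMem fun i hi => ?_
      rcases hi with h | h
      · exact Set.eq_empty_iff_forall_notMem.1 hS i h
      · exact Set.eq_empty_iff_forall_notMem.1 hS (i + 1) h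
    rw [hempty, Set.ncard_empty]
    exact Nat.zero_le _
  obtain ⟨a, ha⟩ := exists_arc_of_cycleDist_le (m := 2 * k) (by omega) hS (by
    intro i hi j hj
    rw [← hf.2 i j]
    have hi : G.dist (f i) v ≤ k := hi
    have hj : G.dist (f j) v ≤ k := hj
    have h := hG.dist_triangle (u := f i) (v := v) (w := f j)
    rw [G.dist_comm (u := v)] at h
    omega)
  have hsub : {i : ZMod q | v ∈ edisk G k (f i) (f (i + 1))} ⊆
      ((Finset.range (2 * k + 2)).image fun c : ℕ => a - 1 + (c : ZMod q) : Finset (ZMod q)) := by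
    intro i hi
    rw [Finset.coe_image]
    rcases hi with h | h
    · refine ⟨(i - a).val + 1, ?_, ?_⟩
      · have := ha i h
        simp only [Finset.coe_range, Set.mem_Iio]
        omega
      · simp only [Nat.cast_add, ZMod.natCast_zmod_val, Nat.cast_one]
        ring
    · refine ⟨(i + 1 - a).val, ?_, ?_⟩
      · have := ha (i + 1) h
        simp only [Finset.coe_range, Set.mem_Iio]
        omega
      · simp only [ZMod.natCast_zmod_val]
        ring
  refine (Set.ncard_le_ncard hsub (Set.toFinite _)).trans ?_
  rw [Set.ncard_coe_finset]
  exact Finset.card_image_le.trans (Finset.card_range _).le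

theorem IsIsoCycle.adj {V : Type*} {G : SimpleGraph V} {q : ℕ} {f : ZMod q → V}
    (hf : IsIsoCycle G q f) (i : ZMod q) : G.Adj (f i) (f (i + 1)) := by
  have hq := hf.1
  have : Fact (1 < q) := ⟨by omega⟩
  have : NeZero q := ⟨by omega⟩
  rw [← dist_eq_one_iff_adj, hf.2, cycleDist, add_sub_cancel_left, ZMod.val_one]
  refine min_eq_right (Nat.one_le_iff_ne_zero.2 fun h => ?_)
  rw [ZMod.val_eq_zero, sub_add_cancel_left, neg_eq_zero] at h
  exact one_ne_zero h

/-- Lemma 3.2: even-girth lower bound `n ≥ (q/g)·M(δ,g)`. -/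
theorem stmt_1 {V : Type*} [Fintype V] (G : SimpleGraph V) (G_conn : G.Connected)
    (n q g k δ : ℕ) (hn : n = Nat.card V)
    (hg : G.girth = g) (heven : g = 2 * k + 2)
    (hδ : HasMinDegree G δ)
    (hq : IsEquator G q) (hq' : 6 * k + 3 < q) :
    g * n ≥ q * mooreBound δ g := by
  classical
  obtain ⟨f, hf⟩ : HasIsoCycle G q := hq.1.resolve_right fun h => by omega
  have : NeZero q := ⟨by omega⟩
  subst heven
  have hcount := Finset.card_mul_le_card_mul (s := (Finset.univ : Finset (ZMod q)))
    (t := (Finset.univ : Finset V)) (m := mooreBound δ (2 * k + 2)) (n := 2 * k + 2)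
    (fun i v => v ∈ edisk G k (f i) (f (i + 1)))
    (fun i _ => by
      have h := mooreBound_le_ncard_edisk G_conn (hf.adj i) hδ.1 (k := k) (by omega)
      rw [Set.ncard_eq_toFinset_card'] at h
      refine h.trans (Finset.card_le_card fun v hv => ?_)
      simpa [Finset.mem_bipartiteAbove] using hv)
    (fun v _ => by
      have h := ncard_setOf_mem_edisk_le G_conn hf (by omega : 6 * k < q) v
      rw [Set.ncard_eq_toFinset_card'] at h
      refine (Finset.card_le_card fun i hi => ?_).trans h
      simpa [Finset.mem_bipartiteBelow] using hi)
  rw [Finset.card_univ, Finset.card_univ, ZMod.card, ← Nat.card_eq_fintype_card, ← hn] at hcount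
  rwa [ge_iff_le, mul_comm (2 * k + 2) n]
end

section
/- Let G be a finite connected simple graph with order n, girth g, k = ⌈g/2⌉ − 1, minimum degree δ and equator q > 6k + 3. Then g·n ≥ q·M(δ, g), i.e. n ≥ (q/g)·M(δ, g). -/
open SimpleGraph

/-- A walk joining the ends of an edge that it avoids closes up to a cycle. -/
theorem exists_isCycle_of_walk_avoiding_edge {V : Type*} {G : SimpleGraph V} {x y : V}
    (h : G.Adj x y) (p : G.Walk y x) (hp : s(x, y) ∉ p.edges) :
    ∃ c : G.Walk x x, c.IsCycle ∧ c.length ≤ p.length + 1 := by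
  classical
  refine ⟨.cons h p.bypass, (Walk.cons_isCycle_iff _ h).2 ⟨p.bypass_isPath,
    fun he => hp (p.edges_bypass_subset_edges he)⟩, ?_⟩
  simpa using p.length_bypass_le_length

/-- The distance from `x` to the pair `{u, v}`. -/
noncomputable def pairDist {V : Type*} (G : SimpleGraph V) (u v x : V) : ℕ :=
  min (G.dist u x) (G.dist v x)

theorem pairDist_le_succ {V : Type*} {G : SimpleGraph V} (hG : G.Connected) (u v : V) {x y : V}
    (h : G.Adj x y) : pairDist G u v y ≤ pairDist G u v x + 1 := by
  have h1 := hG.dist_triangle (u := u) (v := x) (w := y)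
  have h2 := hG.dist_triangle (u := v) (v := x) (w := y)
  have h3 := dist_eq_one_iff_adj.2 h
  unfold pairDist
  omega

theorem pairDist_eq_zero {V : Type*} {G : SimpleGraph V} (hG : G.Connected) (u v x : V) :
    pairDist G u v x = 0 ↔ x = u ∨ x = v := by
  rw [pairDist, Nat.min_eq_zero_iff, hG.dist_eq_zero_iff, hG.dist_eq_zero_iff, eq_comm,
    eq_comm (a := v)]

/-- A geodesic ending at `a` meets vertices at distance at least `G.dist r a` only at `a`. -/
theorem dist_lt_of_mem_support_geodesic {V : Type*} {G : SimpleGraph V} {r a w : V}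
    (p : G.Walk r a) (hp : p.length = G.dist r a) (hw : w ∈ p.support) (hwa : w ≠ a) :
    G.dist r w < G.dist r a := by
  classical
  exact (dist_le (p.takeUntil w hw)).trans_lt (hp ▸ p.length_takeUntil_lt_length hw hwa)

theorem exists_walk_from_pair {V : Type*} {G : SimpleGraph V} (hG : G.Connected) (u v a : V) :
    ∃ r, (r = u ∨ r = v) ∧ ∃ p : G.Walk r a, p.length = pairDist G u v a ∧
      ∀ w ∈ p.support, w = a ∨ pairDist G u v w < pairDist G u v a := by
  have key : ∀ r, (r = u ∨ r = v) → G.dist r a = pairDist G u v a →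
      ∃ r, (r = u ∨ r = v) ∧ ∃ p : G.Walk r a, p.length = pairDist G u v a ∧
        ∀ w ∈ p.support, w = a ∨ pairDist G u v w < pairDist G u v a := by
    intro r hr hd
    obtain ⟨p, hp⟩ := hG.exists_walk_length_eq_dist r a
    refine ⟨r, hr, p, hp.trans hd, fun w hw => or_iff_not_imp_left.2 fun hwa => ?_⟩
    have h1 := dist_lt_of_mem_support_geodesic p hp hw hwa
    have h2 : pairDist G u v w ≤ G.dist r w := by
      rcases hr with rfl | rfl <;> simp [pairDist]
    omega
  rcases le_total (G.dist u a) (G.dist v a) with h | h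
  · exact key u (.inl rfl) (by simp [pairDist, h])
  · exact key v (.inr rfl) (by simp [pairDist, h])

theorem exists_walk_between_pair {V : Type*} {G : SimpleGraph V} (hG : G.Connected) {u v : V}
    (huv : G.dist u v ≤ 1) {r s : V} (hr : r = u ∨ r = v) (hs : s = u ∨ s = v) :
    ∃ p : G.Walk r s, p.length ≤ G.dist u v ∧ ∀ w ∈ p.support, w = r ∨ w = s := by
  obtain ⟨p, hp⟩ := hG.exists_walk_length_eq_dist r s
  have hle : G.dist r s ≤ G.dist u v := by
    rcases hr with rfl | rfl <;> rcases hs with rfl | rfl <;> simp [dist_comm]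
  refine ⟨p, hp.trans_le hle, fun w hw => or_iff_not_imp_right.2 fun hws => ?_⟩
  have h1 := dist_lt_of_mem_support_geodesic p hp hw hws
  exact (hG.dist_eq_zero_iff.1 (by omega : G.dist r w = 0)).symm

theorem exists_walk_through_pair {V : Type*} {G : SimpleGraph V} (hG : G.Connected) {u v : V}
    (huv : G.dist u v ≤ 1) (a b : V) :
    ∃ p : G.Walk a b, p.length ≤ pairDist G u v a + pairDist G u v b + G.dist u v ∧
      ∀ w ∈ p.support, w = a ∨ w = b ∨
        pairDist G u v w < max (pairDist G u v a) (pairDist G u v b) := by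
  obtain ⟨r, hr, p, hp, hps⟩ := exists_walk_from_pair hG u v a
  obtain ⟨s, hs, q, hq, hqs⟩ := exists_walk_from_pair hG u v b
  obtain ⟨m, hm, hms⟩ := exists_walk_between_pair hG huv hr hs
  refine ⟨p.reverse.append (m.append q), ?_, fun w hw => ?_⟩
  · simp only [Walk.length_append, Walk.length_reverse]
    omega
  · have hp' : w ∈ p.support → w = a ∨ w = b ∨
        pairDist G u v w < max (pairDist G u v a) (pairDist G u v b) := fun h =>
      (hps w h).imp_right fun h => .inr (lt_max_of_lt_left h)
    have hq' : w ∈ q.support → w = a ∨ w = b ∨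
        pairDist G u v w < max (pairDist G u v a) (pairDist G u v b) := fun h =>
      .inr ((hqs w h).imp_right lt_max_of_lt_right)
    simp only [Walk.mem_support_append_iff, Walk.support_reverse, List.mem_reverse] at hw
    rcases hw with hw | hw | hw
    · exact hp' hw
    · rcases hms w hw with rfl | rfl
      · exact hp' p.start_mem_support
      · exact hq' q.start_mem_support
    · exact hq' hw

/-- Below the girth, at most one neighbour of `x` is no farther than `x` from the pair. -/
theorem eq_of_adj_of_pairDist_le {V : Type*} {G : SimpleGraph V} (hG : G.Connected) {u v : V}
    {k : ℕ} (huv : G.dist u v ≤ 1) (hg : G.girth = 2 * k + 1 + G.dist u v) {x y z : V}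
    (hy : G.Adj x y) (hz : G.Adj x z) (hyx : pairDist G u v y ≤ pairDist G u v x)
    (hzx : pairDist G u v z ≤ pairDist G u v x) (hyk : pairDist G u v y < k)
    (hzk : pairDist G u v z < k) : y = z := by
  by_contra hyz
  obtain ⟨p, hp, hps⟩ := exists_walk_through_pair hG huv y z
  have hx : x ∉ p.support := fun h => by
    rcases hps x h with h | h | h
    · exact hy.ne h
    · exact hz.ne h
    · omega
  obtain ⟨c, hc, hcl⟩ := exists_isCycle_of_walk_avoiding_edge hy (p.concat hz.symm) (by
    rw [Walk.edges_concat, List.concat_eq_append, List.mem_append, List.mem_singleton]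
    rintro (h | h)
    · exact hx (p.fst_mem_support_of_mem_edges h)
    · rw [Sym2.eq_swap, Sym2.congr_left] at h
      exact hyz h)
  have := girth_le_length hc
  rw [Walk.length_concat] at hcl
  omega

/-- The number of vertices at distance exactly `i` from the pair `{u, v}`. -/
noncomputable def levelCard {V : Type*} (G : SimpleGraph V) (u v : V) (i : ℕ) : ℕ :=
  {x | pairDist G u v x = i}.ncard

theorem levelCard_mul_le {V : Type*} [Finite V] {G : SimpleGraph V} (hG : G.Connected) {u v : V}
    {k m i : ℕ} (huv : G.dist u v ≤ 1) (hg : G.girth = 2 * k + 1 + G.dist u v) (hi : i < k)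
    (hm : ∀ x, pairDist G u v x = i → m ≤ {y | G.Adj x y ∧ pairDist G u v y = i + 1}.ncard) :
    levelCard G u v i * m ≤ levelCard G u v (i + 1) := by
  classical
  have := Fintype.ofFinite V
  have h := Finset.card_mul_le_card_mul (s := {x | pairDist G u v x = i})
    (t := {x | pairDist G u v x = i + 1}) (m := m) (n := 1) G.Adj (fun x hx => ?_) (fun y hy => ?_)
  · simpa [levelCard, Set.ncard_eq_toFinset_card'] using h
  · refine (hm x (by simpa using hx)).trans_eq ?_
    rw [Set.ncard_eq_toFinset_card']
    congr 1
    ext y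
    simp [Finset.mem_bipartiteAbove, and_comm]
  · refine Finset.card_le_one.2 fun a ha b hb => ?_
    simp only [Finset.mem_bipartiteBelow, Finset.mem_filter, Finset.mem_univ, true_and] at ha hb hy
    exact eq_of_adj_of_pairDist_le hG huv hg ha.2.symm hb.2.symm (by omega) (by omega) (by omega)
      (by omega)

theorem levelCard_mul_pred_le {V : Type*} [Finite V] {G : SimpleGraph V} (hG : G.Connected)
    {u v : V} {k δ i : ℕ} (huv : G.dist u v ≤ 1) (hg : G.girth = 2 * k + 1 + G.dist u v)
    (hδ : ∀ x, δ ≤ ndeg G x) (hi : i < k) :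
    levelCard G u v i * (δ - 1) ≤ levelCard G u v (i + 1) := by
  refine levelCard_mul_le hG huv hg hi fun x hx => ?_
  have hsub : G.neighborSet x ⊆ {y | G.Adj x y ∧ pairDist G u v y = i + 1} ∪
      {y | G.Adj x y ∧ pairDist G u v y ≤ i} := fun y (hy : G.Adj x y) => by
    have := pairDist_le_succ hG u v hy
    simp only [Set.mem_union, Set.mem_ofPred_eq, hy, true_and]
    omega
  have h1 : {y | G.Adj x y ∧ pairDist G u v y ≤ i}.ncard ≤ 1 :=
    (Set.ncard_le_one (Set.toFinite _)).2 fun a ha b hb => by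
      have ha' := ha.2
      have hb' := hb.2
      exact eq_of_adj_of_pairDist_le hG huv hg ha.1 hb.1 (by omega) (by omega) (by omega) (by omega)
  have h2 := (hδ x).trans ((Set.ncard_le_ncard hsub).trans (Set.ncard_union_le _ _))
  omega

theorem le_levelCard_one {V : Type*} [Finite V] {G : SimpleGraph V} {u : V} {δ : ℕ}
    (hδ : ∀ x, δ ≤ ndeg G x) : δ ≤ levelCard G u u 1 := by
  refine (hδ u).trans (Set.ncard_le_ncard fun y (hy : G.Adj u y) => ?_)
  simpa [pairDist] using hy

theorem levelCard_zero {V : Type*} {G : SimpleGraph V} (hG : G.Connected) (u v : V) :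
    levelCard G u v 0 = ({u, v} : Set V).ncard := by
  unfold levelCard
  congr 1
  ext x
  simp [pairDist_eq_zero hG]

theorem sum_levelCard {V : Type*} [Finite V] (G : SimpleGraph V) (u v : V) (k : ℕ) :
    ∑ i ∈ Finset.range (k + 1), levelCard G u v i = {x | pairDist G u v x ≤ k}.ncard := by
  classical
  have := Fintype.ofFinite V
  simp only [levelCard, Set.ncard_eq_toFinset_card']
  rw [Finset.card_eq_sum_card_fiberwise (f := pairDist G u v) (t := Finset.range (k + 1))
    (fun x hx => by simpa [Nat.lt_succ_iff] using hx)]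
  refine Finset.sum_congr rfl fun i hi => ?_
  congr 1
  ext x
  have := Finset.mem_range.1 hi
  simp only [Set.mem_toFinset, Set.mem_ofPred_eq, Finset.mem_filter]
  omega

/-- The Moore bound for a disk around a vertex. -/
theorem moore_le_vertex_disk {V : Type*} [Finite V] {G : SimpleGraph V} (hG : G.Connected)
    {k δ : ℕ} (u : V) (hg : G.girth = 2 * k + 1) (hδ : ∀ x, δ ≤ ndeg G x) :
    1 + δ * ∑ i ∈ Finset.range k, (δ - 1) ^ i ≤ {x | pairDist G u u x ≤ k}.ncard := by
  have hpow : ∀ i < k, δ * (δ - 1) ^ i ≤ levelCard G u u (i + 1) := by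
    intro i
    induction i with
    | zero => intro _; simpa using le_levelCard_one hδ
    | succ i ih =>
      intro hi
      rw [pow_succ, ← mul_assoc]
      exact (Nat.mul_le_mul_right _ (ih (by omega))).trans
        (levelCard_mul_pred_le hG (by simp) (by simpa using hg) hδ hi)
  rw [← sum_levelCard, Finset.sum_range_succ', levelCard_zero hG, Finset.mul_sum, add_comm]
  simpa using Finset.sum_le_sum fun i hi => hpow i (Finset.mem_range.1 hi)

/-- The Moore bound for a disk around an edge. -/
theorem moore_le_edge_disk {V : Type*} [Finite V] {G : SimpleGraph V} (hG : G.Connected)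
    {k δ : ℕ} {u v : V} (huv : G.dist u v = 1) (hg : G.girth = 2 * k + 2)
    (hδ : ∀ x, δ ≤ ndeg G x) :
    2 + ∑ i ∈ Finset.Icc 1 k, 2 * (δ - 1) ^ i ≤ {x | pairDist G u v x ≤ k}.ncard := by
  have h0 : levelCard G u v 0 = 2 := by
    rw [levelCard_zero hG, Set.ncard_pair (dist_eq_one_iff_adj.1 huv).ne]
  have hpow : ∀ i ≤ k, 2 * (δ - 1) ^ i ≤ levelCard G u v i := by
    intro i
    induction i with
    | zero => simp [h0]
    | succ i ih =>
      intro hi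
      rw [pow_succ, ← mul_assoc]
      exact (Nat.mul_le_mul_right _ (ih (by omega))).trans
        (levelCard_mul_pred_le hG huv.le (by omega) hδ hi)
  rw [← sum_levelCard, Finset.sum_range_succ', h0, add_comm,
    ← Finset.Ico_add_one_right_eq_Icc, Finset.sum_Ico_eq_sum_range, Nat.add_sub_cancel]
  refine Nat.add_le_add_right (Finset.sum_le_sum fun i hi => ?_) 2
  rw [add_comm 1 i]
  exact hpow (i + 1) (Finset.mem_range.1 hi)

theorem ZMod.val_sub_le_of_cycleDist_le {q k : ℕ} (hq : 6 * k < q) {A : Set (ZMod q)}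
    (hA : A.Nonempty) (h : ∀ i ∈ A, ∀ j ∈ A, cycleDist i j ≤ 2 * k) :
    ∃ j ∈ A, ∀ i ∈ A, (i - j).val ≤ 2 * k := by
  have : NeZero q := ⟨by omega⟩
  obtain ⟨a, ha⟩ := hA
  have hval : ∀ i ∈ A, (i - a + (2 * k : ℕ)).val ≤ 4 * k := by
    intro i hi
    have hd := h i hi a ha
    rw [cycleDist, min_le_iff] at hd
    rcases hd with hd | hd
    · calc (i - a + (2 * k : ℕ)).val ≤ (i - a).val + ((2 * k : ℕ) : ZMod q).val :=
            ZMod.val_add_le _ _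
        _ ≤ 4 * k := by rw [ZMod.val_cast_of_lt (by omega)]; omega
    · have e : i - a + (2 * k : ℕ) = ((2 * k - (a - i).val : ℕ) : ZMod q) := by
        rw [Nat.cast_sub hd, ZMod.natCast_zmod_val]
        ring
      rw [e, ZMod.val_cast_of_lt (by omega)]
      omega
  obtain ⟨j, hj, hmin⟩ := Set.exists_min_image A (fun i => (i - a + (2 * k : ℕ)).val)
    A.toFinite ⟨a, ha⟩
  refine ⟨j, hj, fun i hi => ?_⟩
  have hle := hmin i hi
  have hi4 := hval i hi
  have e : (i - j).val = (i - a + (2 * k : ℕ)).val - (j - a + (2 * k : ℕ)).val := by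
    rw [← ZMod.val_sub hle]
    congr 1
    ring
  have hd := h i hi j hj
  rw [cycleDist, min_le_iff] at hd
  rcases hd with hd | hd
  · exact hd
  · have hsum : (i - j).val + (j - i).val = 0 := by
      rw [← ZMod.val_add_of_lt (by omega)]
      simp
    omega

theorem IsIsoCycle.ncard_centers_le {V : Type*} {G : SimpleGraph V} (hG : G.Connected) {q k c : ℕ}
    {f : ZMod q → V} (hf : IsIsoCycle G q f) (hq : 6 * k < q) (x : V) :
    {i : ZMod q | pairDist G (f i) (f (i + c)) x ≤ k}.ncard ≤ 2 * k + 1 + c := by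
  have : NeZero q := ⟨by omega⟩
  rcases Set.eq_empty_or_nonempty {i : ZMod q | G.dist (f i) x ≤ k} with hA | hA
  · have hfar : ∀ i : ZMod q, ¬ G.dist (f i) x ≤ k := fun i hi =>
      (Set.eq_empty_iff_forall_notMem.1 hA i) hi
    simp [pairDist, hfar]
  obtain ⟨j, -, hj⟩ := ZMod.val_sub_le_of_cycleDist_le hq hA fun a ha b hb => by
    rw [← hf.2]
    have h1 := hG.dist_triangle (u := f a) (v := x) (w := f b)
    rw [dist_comm (u := x)] at h1
    have ha' : G.dist (f a) x ≤ k := ha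
    have hb' : G.dist (f b) x ≤ k := hb
    omega
  have hsub : {i : ZMod q | pairDist G (f i) (f (i + c)) x ≤ k} ⊆
      Set.image (fun s : ℕ => j - c + s) (Finset.range (2 * k + 1 + c)) := by
    intro i hi
    rcases min_le_iff.1 (show min _ _ ≤ k from hi) with h | h
    · have := hj i h
      refine ⟨(i - j).val + c, by simp; omega, ?_⟩
      simp
    · have := hj (i + c) h
      refine ⟨(i + c - j).val, by simp; omega, ?_⟩
      simp
  refine (Set.ncard_le_ncard hsub).trans ((Set.ncard_image_le (Finset.finite_toSet _)).trans ?_)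
  simp

theorem IsIsoCycle.card_mul_le {V : Type*} [Finite V] {G : SimpleGraph V} (hG : G.Connected)
    {q k c M : ℕ} {f : ZMod q → V} (hf : IsIsoCycle G q f) (hq : 6 * k < q)
    (hM : ∀ i, M ≤ {x | pairDist G (f i) (f (i + c)) x ≤ k}.ncard) :
    q * M ≤ Nat.card V * (2 * k + 1 + c) := by
  classical
  have : NeZero q := ⟨by omega⟩
  have := Fintype.ofFinite V
  have h := Finset.card_mul_le_card_mul (s := (Finset.univ : Finset (ZMod q)))
    (t := (Finset.univ : Finset V)) (m := M) (n := 2 * k + 1 + c)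
    (fun i x => pairDist G (f i) (f (i + c)) x ≤ k) (fun i _ => ?_) (fun x _ => ?_)
  · simpa [ZMod.card] using h
  · simpa [Finset.bipartiteAbove, Set.ncard_eq_toFinset_card'] using hM i
  · simpa [Finset.bipartiteBelow, Set.ncard_eq_toFinset_card'] using
      hf.ncard_centers_le hG (c := c) hq x

theorem IsIsoCycle.dist_succ {V : Type*} {G : SimpleGraph V} {q : ℕ} {f : ZMod q → V}
    (hf : IsIsoCycle G q f) (i : ZMod q) : G.dist (f i) (f (i + 1)) = 1 := by
  have hq := hf.1
  have : Fact (1 < q) := ⟨by omega⟩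
  have : NeZero q := ⟨by omega⟩
  have h : (-1 : ZMod q).val ≠ 0 := by simp [ZMod.val_eq_zero]
  rw [hf.2, cycleDist]
  simp only [sub_add_cancel_left, add_sub_cancel_left, ZMod.val_one]
  omega

theorem IsIsoCycle.injective {V : Type*} {G : SimpleGraph V} {q : ℕ} {f : ZMod q → V}
    (hf : IsIsoCycle G q f) : Function.Injective f := by
  intro i j hij
  have h := hf.2 i j
  rw [hij, dist_self, cycleDist, eq_comm, Nat.min_eq_zero_iff] at h
  rcases h with h | h
  · exact sub_eq_zero.1 ((ZMod.val_eq_zero _).1 h)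
  · exact (sub_eq_zero.1 ((ZMod.val_eq_zero _).1 h)).symm

theorem IsIsoCycle.not_isAcyclic {V : Type*} {G : SimpleGraph V} {q : ℕ} {f : ZMod q → V}
    (hf : IsIsoCycle G q f) : ¬ G.IsAcyclic := by
  have hq := hf.1
  have hadj : ∀ i : ZMod q, G.Adj (f i) (f (i + 1)) := fun i =>
    dist_eq_one_iff_adj.1 (hf.dist_succ i)
  have hcast : ∀ j : ℕ, 0 < j → j < q → (j : ZMod q) ≠ 0 := fun j h0 hj h => by
    rw [ZMod.natCast_eq_zero_iff] at h
    exact absurd (Nat.le_of_dvd h0 h) (by omega)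
  have hwalk : ∀ m : ℕ, ∃ p : G.Walk (f 1) (f ((m + 1 : ℕ) : ZMod q)),
      ∀ w ∈ p.support, ∃ j : ℕ, 0 < j ∧ j ≤ m + 1 ∧ w = f j := by
    intro m
    induction m with
    | zero => exact ⟨Walk.nil.copy rfl (by simp), by simpa using ⟨1, by simp⟩⟩
    | succ m ih =>
      obtain ⟨p, hp⟩ := ih
      refine ⟨p.concat (by simpa using hadj ((m + 1 : ℕ) : ZMod q)), fun w hw => ?_⟩
      rw [Walk.support_concat, List.mem_append, List.mem_singleton] at hw
      rcases hw with hw | hw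
      · obtain ⟨j, h0, hj, rfl⟩ := hp w hw
        exact ⟨j, h0, by omega, rfl⟩
      · exact ⟨m + 1 + 1, by omega, le_rfl, hw⟩
  obtain ⟨p, hp⟩ := hwalk (q - 2)
  have hend : ((q - 2 + 1 : ℕ) : ZMod q) + 1 = 0 := by
    rw [← Nat.cast_add_one, show q - 2 + 1 + 1 = q by omega, ZMod.natCast_self]
  have hlast : G.Adj (f ((q - 2 + 1 : ℕ) : ZMod q)) (f 0) := hend ▸ hadj _
  have hne : f 1 ≠ f ((q - 2 + 1 : ℕ) : ZMod q) := fun h => by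
    have h' := hf.injective h
    refine hcast 2 (by omega) (by omega) ?_
    rw [← hend, ← h']
    norm_num
  obtain ⟨c, hc, -⟩ := exists_isCycle_of_walk_avoiding_edge (x := f 0) (y := f 1)
    (by simpa using hadj 0) (p.concat hlast) (by
      rw [Walk.edges_concat, List.concat_eq_append, List.mem_append, List.mem_singleton]
      rintro (h | h)
      · obtain ⟨j, h0, hj, he⟩ := hp _ (p.fst_mem_support_of_mem_edges h)
        exact hcast j h0 (by omega) (hf.injective he).symm
      · rw [Sym2.eq_swap, Sym2.congr_left] at h
        exact hne h)
  exact fun h => h c hc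

/-- Theorem 3.3: general lower bound `n ≥ (q/g)·M(δ,g)`. -/
theorem stmt_2 {V : Type*} [Fintype V] (G : SimpleGraph V) (G_conn : G.Connected)
    (n q g k δ : ℕ) (hn : n = Nat.card V)
    (hg : G.girth = g) (hk : k = (g + 1) / 2 - 1)
    (hδ : HasMinDegree G δ)
    (hq : IsEquator G q) (hq' : 6 * k + 3 < q) :
    g * n ≥ q * mooreBound δ g := by
  obtain ⟨f, hf⟩ : HasIsoCycle G q := hq.1.resolve_right fun h => by omega
  have hg3 := three_le_girth hf.not_isAcyclic
  have hq6 : 6 * k < q := by omega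
  rw [ge_iff_le, hn, mul_comm g, mooreBound, ← hk]
  split_ifs with hodd
  · obtain ⟨m, hm⟩ := hodd
    have hgk : g = 2 * k + 1 + 0 := by omega
    rw [hgk]
    refine hf.card_mul_le G_conn hq6 fun i => ?_
    simpa using moore_le_vertex_disk G_conn (f i) (by omega) hδ.1
  · obtain ⟨m, hm⟩ := Nat.not_odd_iff_even.1 hodd
    have hgk : g = 2 * k + 1 + 1 := by omega
    rw [hgk]
    refine hf.card_mul_le G_conn hq6 fun i => ?_
    simpa using moore_le_edge_disk G_conn (hf.dist_succ i) (by omega) hδ.1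
end

section
/- Let G be a finite connected simple graph that contains no 4-cycle (induced or otherwise), with order n, minimum degree δ and equator q > 15. Then 5·n ≥ q·(δ² − 2·⌊δ/2⌋ + 1), i.e. n ≥ (q/5)(δ² − 2⌊δ/2⌋ + 1). -/
open SimpleGraph

/-- A set of indices around a cycle of length `q > 12` with pairwise distances at most `4`
has at most five elements. -/
theorem card_le_five_of_cycleDist_le_four {q : ℕ} (hq : 12 < q) (A : Finset (ZMod q))
    (hA : ∀ i ∈ A, ∀ j ∈ A, cycleDist i j ≤ 4) : A.card ≤ 5 := by
  have : NeZero q := ⟨by omega⟩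
  obtain rfl | ⟨i₀, hi₀⟩ := A.eq_empty_or_nonempty
  · simp
  have near : ∀ a ∈ A, ∃ t : ℕ, t ≤ 8 ∧ a = i₀ - 4 + t := by
    intro a ha
    rcases min_le_iff.1 (hA a ha i₀ hi₀) with h | h
    · refine ⟨4 + (a - i₀).val, by omega, ?_⟩
      push_cast
      rw [ZMod.natCast_zmod_val]
      ring
    · refine ⟨4 - (i₀ - a).val, by omega, ?_⟩
      rw [Nat.cast_sub h, ZMod.natCast_zmod_val]
      push_cast
      ring
  classical
  have hex : ∃ t : ℕ, i₀ - 4 + (t : ZMod q) ∈ A := ⟨4, by simpa using hi₀⟩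
  have hsub : A ⊆ (Finset.range 5).image
      fun k : ℕ => i₀ - 4 + ((Nat.find hex + k : ℕ) : ZMod q) := by
    intro a ha
    obtain ⟨t, ht, rfl⟩ := near a ha
    have hle : Nat.find hex ≤ t := Nat.find_min' hex ha
    obtain ⟨k, rfl⟩ := Nat.exists_eq_add_of_le hle
    refine Finset.mem_image.2 ⟨k, ?_, rfl⟩
    rw [Finset.mem_range]
    rcases min_le_iff.1 (hA _ ha _ (Nat.find_spec hex)) with h | h
    · have e : i₀ - 4 + ((Nat.find hex + k : ℕ) : ZMod q) - (i₀ - 4 + (Nat.find hex : ℕ))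
          = (k : ZMod q) := by push_cast; ring
      rw [e, ZMod.val_natCast_of_lt (by omega)] at h
      omega
    · set x : ZMod q := i₀ - 4 + (Nat.find hex : ℕ) -
        (i₀ - 4 + ((Nat.find hex + k : ℕ) : ZMod q)) with hx
      have e : ((x.val + k : ℕ) : ZMod q) = 0 := by
        push_cast
        rw [ZMod.natCast_zmod_val, hx]
        push_cast
        ring
      have hdvd := (ZMod.natCast_eq_zero_iff _ _).1 e
      have := Nat.eq_zero_of_dvd_of_lt hdvd (by omega)
      omega
  exact (Finset.card_le_card hsub).trans (Finset.card_image_le.trans (by simp))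

/-- If every vertex of `S` has at most one neighbor in `S`, then the number of ordered pairs of
adjacent vertices of `S` is at most the largest even number not exceeding the size of `S`. -/
theorem sum_card_neighbors_le_of_matching {V : Type*} [Fintype V] [DecidableEq V]
    (G : SimpleGraph V) [DecidableRel G.Adj] (S : Finset V)
    (hS : ∀ w ∈ S, (S.filter (G.Adj w)).card ≤ 1) :
    ∑ w ∈ S, (S.filter (G.Adj w)).card ≤ 2 * (S.card / 2) := by
  classical
  let H : SimpleGraph V :=
    { Adj := fun a b => G.Adj a b ∧ a ∈ S ∧ b ∈ S
      symm := ⟨fun _ _ h => ⟨h.1.symm, h.2.2, h.2.1⟩⟩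
      loopless := ⟨fun _ h => G.irrefl h.1⟩ }
  have hdeg : ∀ w ∈ S, H.degree w = (S.filter (G.Adj w)).card := by
    intro w hw
    rw [← H.card_neighborFinset_eq_degree]
    congr 1
    ext x
    simp [H, hw, and_comm]
  have hzero : ∀ w ∉ S, H.degree w = 0 := by
    intro w hw
    rw [← H.card_neighborFinset_eq_degree, Finset.card_eq_zero]
    ext x
    simp [H, hw]
  have hsum : ∑ w ∈ S, (S.filter (G.Adj w)).card = 2 * H.edgeFinset.card := by
    rw [← H.sum_degrees_eq_twice_card_edges, ← Finset.sum_congr rfl hdeg]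
    exact Finset.sum_subset (Finset.subset_univ S) fun w _ hw => hzero w hw
  have hle := Finset.sum_le_card_nsmul S _ 1 hS
  rw [smul_eq_mul, mul_one] at hle
  omega

/-- In a graph without 4-cycles, a disk of radius two has at least
`δ ^ 2 - 2 * ⌊δ / 2⌋ + 1` vertices, where `δ` bounds the degrees from below. -/
theorem le_card_disk_two_of_c4_free {V : Type*} [Fintype V] [DecidableEq V]
    (G : SimpleGraph V) [DecidableRel G.Adj]
    (hC4 : ∀ a b c d : V, G.Adj a b → G.Adj b c → G.Adj c d → G.Adj d a → a = c ∨ b = d)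
    (δ : ℕ) (hδ : ∀ v, δ ≤ G.degree v) (u : V) :
    δ ^ 2 - 2 * (δ / 2) + 1 ≤ (Finset.univ.filter fun v => G.dist u v ≤ 2).card := by
  obtain ⟨S, hSN, hcard⟩ := Finset.exists_subset_card_eq
    ((hδ u).trans_eq (G.card_neighborFinset_eq_degree u).symm)
  have hSu : ∀ w ∈ S, G.Adj u w := fun w hw => by simpa using hSN hw
  let outer : V → Finset V := fun w => (G.neighborFinset w \ {u}) \ S
  have houter : ∀ w x, x ∈ outer w ↔ (G.Adj w x ∧ x ≠ u) ∧ x ∉ S := by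
    intro w x
    simp [outer]
  have hmatch : ∀ w ∈ S, (S.filter (G.Adj w)).card ≤ 1 := by
    intro w hw
    rw [Finset.card_le_one]
    intro a ha b hb
    rw [Finset.mem_filter] at ha hb
    refine (hC4 u a w b (hSu a ha.1) ha.2.symm hb.2 (hSu b hb.1).symm).resolve_left ?_
    exact (hSu w hw).ne
  have hdegree : ∀ w ∈ S, δ ≤ 1 + (S.filter (G.Adj w)).card + (outer w).card := by
    intro w hw
    have hsub : G.neighborFinset w ⊆ ({u} ∪ S.filter (G.Adj w)) ∪ outer w := by
      intro x hx
      rw [mem_neighborFinset] at hx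
      simp only [Finset.mem_union, Finset.mem_singleton, Finset.mem_filter, houter]
      tauto
    have h := (hδ w).trans_eq (G.card_neighborFinset_eq_degree w).symm
    have h₁ := Finset.card_le_card hsub
    have h₂ := Finset.card_union_le ({u} ∪ S.filter (G.Adj w)) (outer w)
    have h₃ := Finset.card_union_le {u} (S.filter (G.Adj w))
    rw [Finset.card_singleton] at h₃
    omega
  have hdisj : (S : Set V).PairwiseDisjoint outer := by
    intro w hw z hz hwz
    refine Finset.disjoint_left.2 fun x hx hx' => hwz ?_
    rw [houter] at hx hx'
    exact (hC4 u w x z (hSu w hw) hx.1.1 hx'.1.1.symm (hSu z hz).symm).resolve_left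
      hx.1.2.symm
  have hsubset : insert u (S ∪ S.biUnion outer) ⊆
      Finset.univ.filter fun v => G.dist u v ≤ 2 := by
    intro x hx
    rw [Finset.mem_filter]
    refine ⟨Finset.mem_univ x, ?_⟩
    rw [Finset.mem_insert, Finset.mem_union, Finset.mem_biUnion] at hx
    rcases hx with rfl | hx | ⟨w, hw, hx⟩
    · simp
    · exact (dist_eq_one_iff_adj.2 (hSu x hx)).le.trans one_le_two
    · exact dist_le (Walk.cons (hSu w hw) (Walk.cons ((houter w x).1 hx).1.1 Walk.nil))
  have hcount : (insert u (S ∪ S.biUnion outer)).card =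
      δ + ∑ w ∈ S, (outer w).card + 1 := by
    rw [Finset.card_insert_of_notMem, Finset.card_union_of_disjoint, Finset.card_biUnion hdisj,
      hcard]
    · refine Finset.disjoint_left.2 fun x hx hx' => ?_
      obtain ⟨w, -, hw⟩ := Finset.mem_biUnion.1 hx'
      exact ((houter w x).1 hw).2 hx
    · rw [Finset.mem_union, Finset.mem_biUnion]
      rintro (hu | ⟨w, -, hw⟩)
      · exact (hSu u hu).ne rfl
      · exact ((houter w u).1 hw).1.2 rfl
  have hsum := Finset.sum_le_sum hdegree
  simp only [Finset.sum_add_distrib, Finset.sum_const, smul_eq_mul, hcard, mul_one] at hsum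
  have hpairs := sum_card_neighbors_le_of_matching G S hmatch
  rw [hcard] at hpairs
  have := Finset.card_le_card hsubset
  rw [sq]
  omega

/-- Proposition 3.5: lower bound for `C₄`-free graphs. -/
theorem stmt_3 {V : Type*} [Fintype V] (G : SimpleGraph V) (G_conn : G.Connected)
    (hC4 : ∀ a b c d : V, G.Adj a b → G.Adj b c → G.Adj c d → G.Adj d a → a = c ∨ b = d)
    (n q δ : ℕ) (hn : n = Nat.card V)
    (hδ : HasMinDegree G δ)
    (hq : IsEquator G q) (hq' : 15 < q) :
    5 * n ≥ q * (δ ^ 2 - 2 * (δ / 2) + 1) := by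
  classical
  obtain ⟨f, -, hf⟩ := hq.1.resolve_right (by omega)
  have : NeZero q := ⟨by omega⟩
  have hdeg : ∀ v, δ ≤ G.degree v := by
    intro v
    have h := hδ.1 v
    rwa [ndeg, Set.ncard_eq_toFinset_card', ← neighborFinset_def,
      card_neighborFinset_eq_degree] at h
  have hdisks : ∀ i ∈ (Finset.univ : Finset (ZMod q)), δ ^ 2 - 2 * (δ / 2) + 1 ≤
      (Finset.univ.bipartiteAbove (fun (i : ZMod q) v => G.dist (f i) v ≤ 2) i).card :=
    fun i _ => le_card_disk_two_of_c4_free G hC4 δ hdeg (f i)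
  have hcover : ∀ v ∈ (Finset.univ : Finset V),
      (Finset.univ.bipartiteBelow (fun (i : ZMod q) v => G.dist (f i) v ≤ 2) v).card ≤ 5 := by
    intro v _
    refine card_le_five_of_cycleDist_le_four (by omega) _ fun i hi j hj => ?_
    rw [Finset.mem_bipartiteBelow] at hi hj
    have htri := G_conn.dist_triangle (u := f i) (v := v) (w := f j)
    rw [← hf i j]
    rw [G.dist_comm (u := v)] at htri
    omega
  have h := Finset.card_mul_le_card_mul _ hdisks hcover
  rw [Finset.card_univ, Finset.card_univ, ZMod.card, ← Nat.card_eq_fintype_card, ← hn] at h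
  omega
end

section
/- Let j ≥ 3 be an integer, and let g ≥ 3 and δ ≥ 3 be integers for which there exists a Moore graph of girth g and minimum degree δ (that is, a finite connected simple graph with girth g, minimum degree δ and order M(δ, g)). Then there exists a finite connected simple graph that is δ-regular, has girth g, has equator q = j·g, and has order n = j·M(δ, g) = (q/g)·M(δ, g). -/
open SimpleGraph

/-- Two distinct paths with common ends have total length at least the girth. -/
lemma le_length_add_length_of_ne {V : Type*} {G : SimpleGraph V} {g : ℕ} (hG : (g : ℕ∞) ≤ G.egirth)
    {a b : V} {p q : G.Walk a b} (hp : p.IsPath) (hq : q.IsPath) (hne : p ≠ q) :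
    g ≤ p.length + q.length := by
  classical
  set F : SimpleGraph V := fromEdgeSet {e | e ∈ p.edges ∨ e ∈ q.edges} with hF
  have hFG : F ≤ G := by
    intro u v h
    rw [hF, fromEdgeSet_adj] at h
    rcases h.1 with h | h
    exacts [p.adj_of_mem_edges h, q.adj_of_mem_edges h]
  have mem_edgeSet {e : Sym2 V} (he : e ∈ p.edges ∨ e ∈ q.edges) : e ∈ F.edgeSet := by
    rw [hF, edgeSet_fromEdgeSet]
    refine ⟨he, fun hd => ?_⟩
    have : e ∈ G.edgeSet := he.elim (p.edges_subset_edgeSet ·) (q.edges_subset_edgeSet ·)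
    exact G.not_isDiag_of_mem_edgeSet this hd
  have hcyc : ¬ F.IsAcyclic := by
    intro hac
    have h := congrArg Subtype.val ((hac.subsingleton_path a b).elim
      ⟨p.transfer F fun e he => mem_edgeSet (.inl he), hp.transfer _⟩
      ⟨q.transfer F fun e he => mem_edgeSet (.inr he), hq.transfer _⟩)
    have h2 := congrArg (fun r => r.mapLe hFG) h
    refine hne ?_
    have e1 : ∀ (r : G.Walk a b) (hr), (r.transfer F hr).mapLe hFG = r := by
      intro r hr
      apply Walk.ext_support
      simp
    simpa [e1] using h2
  simp only [IsAcyclic, not_forall, not_not] at hcyc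
  obtain ⟨v, c, hc⟩ := hcyc
  have h1 := le_egirth.1 hG _ _ (hc.mapLe hFG)
  have h2 : g ≤ c.length := by simpa using h1
  have h3 : c.edges ⊆ p.edges ++ q.edges := by
    intro e he
    have := c.edges_subset_edgeSet he
    rw [hF, edgeSet_fromEdgeSet] at this
    exact List.mem_append.2 this.1
  have h4 := (hc.edges_nodup.subperm h3).length_le
  simp only [Walk.length_edges, List.length_append] at h4
  omega

/-- Two neighbours of `y` that are no further from `x` than `y` is close a short cycle. -/
lemma le_dist_add_dist_of_adj {V : Type*} {G : SimpleGraph V} {g : ℕ} (hG : (g : ℕ∞) ≤ G.egirth)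
    {x y z z' : V} (hr : G.Reachable y x) (hz : G.Adj y z) (hz' : G.Adj y z') (hne : z ≠ z')
    (hd : G.dist z x ≤ G.dist y x) (hd' : G.dist z' x ≤ G.dist y x) :
    g ≤ G.dist z x + G.dist z' x + 2 := by
  classical
  have aux : ∀ {t}, G.Adj y t → G.dist t x ≤ G.dist y x →
      ∃ p : G.Walk t x, p.length = G.dist t x ∧ p.IsPath ∧ y ∉ p.support := by
    intro t ht htd
    obtain ⟨p, hp, hl⟩ := (ht.symm.reachable.trans hr).exists_path_of_dist
    refine ⟨p, hl, hp, fun hy => ?_⟩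
    have h1 := congrArg Walk.length (p.take_spec hy)
    rw [Walk.length_append] at h1
    have h2 := dist_le (p.dropUntil y hy)
    have h3 : (p.takeUntil y hy).length = 0 := by omega
    exact ht.ne (Walk.eq_of_length_eq_zero h3).symm
  obtain ⟨p, hl, hp, hy⟩ := aux hz hd
  obtain ⟨p', hl', hp', hy'⟩ := aux hz' hd'
  have h := le_length_add_length_of_ne hG (hp.cons (h := hz) hy) (hp'.cons (h := hz') hy')
    (by
      intro h
      have := congrArg Walk.snd h
      simp at this
      exact hne this)
  simp only [Walk.length_cons] at h
  omega

/-- The sphere of radius `i` around `x`. -/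
def sphereSet {V : Type*} (G : SimpleGraph V) (x : V) (i : ℕ) : Set V :=
  {y | G.Reachable y x ∧ G.dist y x = i}

/-- The ball of radius `i` around `x`. -/
def ballSet {V : Type*} (G : SimpleGraph V) (x : V) (i : ℕ) : Set V :=
  {y | G.Reachable y x ∧ G.dist y x ≤ i}

lemma dist_le_succ_of_adj {V : Type*} {G : SimpleGraph V} {x y z : V} (h : G.Adj y z)
    (hr : G.Reachable y x) : G.dist z x ≤ G.dist y x + 1 := by
  obtain ⟨p, hp⟩ := hr.exists_walk_length_eq_dist
  simpa [hp] using dist_le (p.cons h.symm)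

lemma ncard_sphereSet_mul_le {V : Type*} [Finite V] {G : SimpleGraph V} {g : ℕ}
    (hG : (g : ℕ∞) ≤ G.egirth) {x : V} {i d : ℕ} (hi : 2 * i + 2 < g)
    (hdeg : ∀ y ∈ sphereSet G x i, d + 1 ≤ ndeg G y) :
    (sphereSet G x i).ncard * d ≤ (sphereSet G x (i + 1)).ncard := by
  classical
  have := Fintype.ofFinite V
  rw [Set.ncard_eq_toFinset_card', Set.ncard_eq_toFinset_card']
  have key := Finset.card_mul_le_card_mul (s := (sphereSet G x i).toFinset)
    (t := (sphereSet G x (i + 1)).toFinset) (m := d) (n := 1) G.Adj ?_ ?_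
  · simpa using key
  · intro y hy
    rw [Set.mem_toFinset] at hy
    have h1 := hdeg y hy
    rw [ndeg, Set.ncard_eq_toFinset_card'] at h1
    have h2 : ((G.neighborSet y).toFinset \
        (sphereSet G x (i + 1)).toFinset.bipartiteAbove G.Adj y).card ≤ 1 := by
      rw [Finset.card_le_one]
      have near : ∀ z ∈ (G.neighborSet y).toFinset \
          (sphereSet G x (i + 1)).toFinset.bipartiteAbove G.Adj y,
          G.Adj y z ∧ G.dist z x ≤ i := by
        intro z hz
        simp only [Finset.mem_sdiff, Set.mem_toFinset, mem_neighborSet,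
          Finset.mem_bipartiteAbove, not_and'] at hz
        refine ⟨hz.1, ?_⟩
        have h3 := hz.2 hz.1
        have h4 := dist_le_succ_of_adj hz.1 hy.1
        have h5 : G.Reachable z x := hz.1.symm.reachable.trans hy.1
        have h6 : G.dist z x ≠ i + 1 := fun h => h3 ⟨h5, h⟩
        have := hy.2
        omega
      intro z hz z' hz'
      by_contra hne
      have hz := near z hz
      have hz' := near z' hz'
      have := le_dist_add_dist_of_adj hG hy.1 hz.1 hz'.1 hne (hy.2 ▸ hz.2) (hy.2 ▸ hz'.2)
      omega
    have h3 := Finset.le_card_sdiff ((sphereSet G x (i + 1)).toFinset.bipartiteAbove G.Adj y)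
      (G.neighborSet y).toFinset
    omega
  · intro y hy
    rw [Set.mem_toFinset] at hy
    rw [Finset.card_le_one]
    intro z hz z' hz'
    simp only [Finset.mem_bipartiteBelow, Set.mem_toFinset] at hz hz'
    by_contra hne
    have e := hy.2
    have e1 := hz.1.2
    have e2 := hz'.1.2
    have := le_dist_add_dist_of_adj hG hy.1 hz.2.symm hz'.2.symm hne (by omega) (by omega)
    omega

lemma sphereSet_one {V : Type*} (G : SimpleGraph V) (x : V) :
    sphereSet G x 1 = G.neighborSet x := by
  ext y
  simp only [sphereSet, Set.mem_ofPred_eq, dist_eq_one_iff_adj,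
    mem_neighborSet]
  exact ⟨fun h => h.2.symm, fun h => ⟨h.symm.reachable, h.symm⟩⟩

lemma le_ncard_sphereSet {V : Type*} [Finite V] {G : SimpleGraph V} {g : ℕ}
    (hG : (g : ℕ∞) ≤ G.egirth) {x : V} {k d : ℕ} (hk : 2 * k < g)
    (hdeg : ∀ y ∈ ballSet G x k, y ≠ x → d + 1 ≤ ndeg G y) {i : ℕ} (hi : i + 1 ≤ k) :
    ndeg G x * d ^ i ≤ (sphereSet G x (i + 1)).ncard := by
  induction i with
  | zero => simp [sphereSet_one, ndeg]
  | succ i ih =>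
    refine le_trans ?_ (ncard_sphereSet_mul_le hG (d := d) (by omega) ?_)
    · rw [pow_succ, ← mul_assoc]
      exact Nat.mul_le_mul_right _ (ih (by omega))
    · rintro y ⟨hy, hy'⟩
      refine hdeg y ⟨hy, by omega⟩ ?_
      rintro rfl
      simp at hy'

lemma le_ncard_ballSet {V : Type*} [Finite V] {G : SimpleGraph V} {g : ℕ}
    (hG : (g : ℕ∞) ≤ G.egirth) {x : V} {k d : ℕ} (hk : 2 * k < g)
    (hdeg : ∀ y ∈ ballSet G x k, y ≠ x → d + 1 ≤ ndeg G y) :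
    1 + ndeg G x * ∑ i ∈ Finset.range k, d ^ i ≤ (ballSet G x k).ncard := by
  have key : ∀ m ≤ k, 1 + ndeg G x * ∑ i ∈ Finset.range m, d ^ i ≤ (ballSet G x m).ncard := by
    intro m hm
    induction m with
    | zero =>
      simp only [Finset.range_zero, Finset.sum_empty, mul_zero, add_zero, Nat.one_le_iff_ne_zero]
      refine Set.ncard_ne_zero_of_mem (a := x) ?_
      exact ⟨.rfl, by simp⟩
    | succ m ih =>
      have h1 : ballSet G x (m + 1) = ballSet G x m ∪ sphereSet G x (m + 1) := by
        ext y
        simp only [ballSet, sphereSet, Set.mem_ofPred_eq, Set.mem_union]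
        constructor
        · rintro ⟨h, h'⟩
          rcases Nat.le_succ_iff.1 h' with h' | h'
          exacts [.inl ⟨h, h'⟩, .inr ⟨h, h'⟩]
        · rintro (⟨h, h'⟩ | ⟨h, h'⟩)
          exacts [⟨h, by omega⟩, ⟨h, by omega⟩]
      have h2 : Disjoint (ballSet G x m) (sphereSet G x (m + 1)) := by
        rw [Set.disjoint_left]
        rintro y ⟨_, h⟩ ⟨_, h'⟩
        omega
      rw [h1, Set.ncard_union_eq h2, Finset.sum_range_succ, mul_add, ← add_assoc]
      exact add_le_add (ih (by omega)) (le_ncard_sphereSet hG hk hdeg hm)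
  exact key k le_rfl

lemma length_of_walk_deleteEdges {V : Type*} {H : SimpleGraph V} {g : ℕ}
    (hH : (g : ℕ∞) ≤ H.egirth) {x w : V} (hxw : H.Adj x w)
    (p : (H.deleteEdges {s(x, w)}).Walk x w) : g ≤ p.length + 1 := by
  classical
  have hle := H.deleteEdges_le {s(x, w)}
  have hcyc : (Walk.cons hxw.symm (p.bypass.mapLe hle)).IsCycle := by
    rw [Walk.cons_isCycle_iff]
    refine ⟨(p.bypass_isPath).mapLe hle, fun he => ?_⟩
    rw [Walk.edges_mapLe_eq_edges] at he
    have := Walk.adj_of_mem_edges _ he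
    rw [deleteEdges_adj] at this
    exact this.2 (by simp [Sym2.eq_swap])
  have h1 := le_egirth.1 hH _ _ hcyc
  have h2 : g ≤ p.bypass.length + 1 := by
    rw [Walk.length_cons, Walk.length_map] at h1
    exact_mod_cast h1
  have := p.length_bypass_le_length
  omega

lemma ndeg_deleteEdges_of_ne {V : Type*} {H : SimpleGraph V} {x w y : V} (hx : y ≠ x)
    (hw : y ≠ w) : ndeg (H.deleteEdges {s(x, w)}) y = ndeg H y := by
  unfold ndeg
  congr 1
  ext z
  simp only [mem_neighborSet, deleteEdges_adj, Set.mem_singleton_iff, Sym2.eq_iff]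
  tauto

lemma ndeg_deleteEdges_left {V : Type*} [Finite V] {H : SimpleGraph V} {x w : V}
    (hxw : H.Adj x w) : ndeg (H.deleteEdges {s(x, w)}) x = ndeg H x - 1 := by
  unfold ndeg
  rw [← Set.ncard_sdiff_singleton_of_mem (s := H.neighborSet x) (a := w) hxw]
  congr 1
  ext z
  have := hxw.ne
  simp only [mem_neighborSet, deleteEdges_adj, Set.mem_singleton_iff, Sym2.eq_iff, Set.mem_sdiff]
  tauto

lemma disjoint_ballSet {V : Type*} {G : SimpleGraph V} {x w : V} {k : ℕ}
    (h : ∀ p : G.Walk x w, 2 * k < p.length) : Disjoint (ballSet G x k) (ballSet G w k) := by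
  rw [Set.disjoint_left]
  rintro y ⟨hr, hd⟩ ⟨hr', hd'⟩
  obtain ⟨p, hp⟩ := hr.exists_walk_length_eq_dist
  obtain ⟨q, hq⟩ := hr'.exists_walk_length_eq_dist
  have := h (p.reverse.append q)
  simp only [Walk.length_append, Walk.length_reverse] at this
  omega

/-- Deleting an edge `xw` with no short detour leaves large balls around `x` and `w`. -/
lemma le_ncard_ballSet_deleteEdges {V : Type*} [Finite V] {H : SimpleGraph V} {g : ℕ}
    (hH : (g : ℕ∞) ≤ H.egirth) {k d : ℕ} (hk : 2 * k < g) (hdeg : ∀ v, d + 1 ≤ ndeg H v)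
    {x w : V} (hxw : H.Adj x w)
    (hfar : ∀ p : (H.deleteEdges {s(x, w)}).Walk x w, 2 * k < p.length) :
    1 + (ndeg H x - 1) * ∑ i ∈ Finset.range k, d ^ i
      ≤ (ballSet (H.deleteEdges {s(x, w)}) x k).ncard := by
  rw [← ndeg_deleteEdges_left hxw]
  refine le_ncard_ballSet (hH.trans (egirth_anti (H.deleteEdges_le _))) hk ?_
  rintro y ⟨hr, hd⟩ hy
  rw [ndeg_deleteEdges_of_ne hy]
  · exact hdeg y
  · rintro rfl
    obtain ⟨p, hp⟩ := hr.exists_walk_length_eq_dist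
    have := hfar p.reverse
    simp only [Walk.length_reverse] at this
    omega

lemma le_ncard_ballSet_union_deleteEdges {V : Type*} [Finite V] {H : SimpleGraph V} {g : ℕ}
    (hH : (g : ℕ∞) ≤ H.egirth) {k d : ℕ} (hk : 2 * k < g) (hdeg : ∀ v, d + 1 ≤ ndeg H v)
    {x w : V} (hxw : H.Adj x w)
    (hfar : ∀ p : (H.deleteEdges {s(x, w)}).Walk x w, 2 * k < p.length) :
    2 + (ndeg H x - 1 + (ndeg H w - 1)) * ∑ i ∈ Finset.range k, d ^ i
      ≤ (ballSet (H.deleteEdges {s(x, w)}) x k ∪ ballSet (H.deleteEdges {s(x, w)}) w k).ncard := by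
  rw [Set.ncard_union_eq (disjoint_ballSet hfar)]
  have h1 := le_ncard_ballSet_deleteEdges hH hk hdeg hxw hfar
  have h2 := le_ncard_ballSet_deleteEdges hH hk hdeg hxw.symm
  rw [Sym2.eq_swap] at h2
  have h2 := h2 fun p => by simpa using hfar p.reverse
  rw [add_mul]
  omega

lemma mooreBound_of_odd (d k : ℕ) :
    mooreBound (d + 1) (2 * k + 1) = 1 + (d + 1) * ∑ i ∈ Finset.range k, d ^ i := by
  rw [mooreBound, if_pos (by simp), show (2 * k + 1 + 1) / 2 - 1 = k by omega]
  simp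

lemma mooreBound_of_even (d k : ℕ) :
    mooreBound (d + 1) (2 * k + 2) = 2 + (d + d) * ∑ i ∈ Finset.range k, d ^ i := by
  rw [mooreBound, if_neg (by simp [parity_simps]), show (2 * k + 2 + 1) / 2 - 1 = k by omega,
    ← two_mul, mul_assoc, ← Finset.mul_sum, Finset.mul_sum (Finset.range k),
    Finset.range_eq_Ico, ← Finset.Ico_add_one_right_eq_Icc, ← Finset.sum_Ico_add' _ 0 k 1]
  simp [pow_succ, mul_comm]

/-- The consequences of attaining the Moore bound: regularity, small diameter, and every edge
lying on a shortest cycle. -/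
structure IsMooreLike {V : Type*} (H : SimpleGraph V) (δ g : ℕ) : Prop where
  regular : ∀ v, ndeg H v = δ
  dist_le : ∀ u v, H.dist u v ≤ g / 2
  detour : ∀ x w, H.Adj x w → ∃ p : (H.deleteEdges {s(x, w)}).Walk x w, p.length + 1 = g

lemma exists_adj_of_ndeg_pos {V : Type*} {H : SimpleGraph V} {v : V} (h : 0 < ndeg H v) :
    ∃ w, H.Adj v w :=
  Set.nonempty_of_ncard_ne_zero h.ne'

lemma isMooreLike_odd {V : Type*} [Finite V] {H : SimpleGraph V} {d k : ℕ} (hk : 1 ≤ k)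
    (hd : 2 ≤ d) (hH : ((2 * k + 1 : ℕ) : ℕ∞) ≤ H.egirth) (hdeg : ∀ v, d + 1 ≤ ndeg H v)
    (hcard : Nat.card V = mooreBound (d + 1) (2 * k + 1)) :
    IsMooreLike H (d + 1) (2 * k + 1) := by
  rw [mooreBound_of_odd] at hcard
  have hS : 0 < ∑ i ∈ Finset.range k, d ^ i :=
    Finset.sum_pos (fun i _ => by positivity) (by simp; omega)
  have hball v := le_ncard_ballSet hH (x := v) (k := k) (by omega) fun y _ _ => hdeg y
  have hreg : ∀ v, ndeg H v = d + 1 := by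
    intro v
    refine le_antisymm ?_ (hdeg v)
    have h1 := (hball v).trans (Set.ncard_le_card _)
    rw [hcard] at h1
    exact Nat.le_of_mul_le_mul_right (by omega) hS
  refine ⟨hreg, fun u v => ?_, fun x w hxw => ?_⟩
  · have h1 : ballSet H v k = Set.univ := by
      rw [Set.eq_univ_iff_ncard]
      refine le_antisymm (Set.ncard_le_card _) ?_
      rw [hcard, ← hreg v]
      exact hball v
    have h2 : u ∈ ballSet H v k := h1 ▸ Set.mem_univ u
    have := h2.2
    omega
  · by_contra hno
    push Not at hno
    have hfar : ∀ p : (H.deleteEdges {s(x, w)}).Walk x w, 2 * k < p.length := by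
      intro p
      have := length_of_walk_deleteEdges hH hxw p
      have := hno p
      omega
    have h1 := (le_ncard_ballSet_union_deleteEdges hH (by omega) hdeg hxw hfar).trans
      (Set.ncard_le_card _)
    rw [hcard, hreg, hreg] at h1
    have h2 : (d + 1) * ∑ i ∈ Finset.range k, d ^ i ≤
        (d + 1 - 1 + (d + 1 - 1)) * ∑ i ∈ Finset.range k, d ^ i :=
      Nat.mul_le_mul_right _ (by omega)
    omega

lemma isMooreLike_even {V : Type*} [Finite V] {H : SimpleGraph V} {d k : ℕ} (hk : 1 ≤ k)
    (hd : 2 ≤ d) (hH : ((2 * k + 2 : ℕ) : ℕ∞) ≤ H.egirth) (hdeg : ∀ v, d + 1 ≤ ndeg H v)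
    (hcard : Nat.card V = mooreBound (d + 1) (2 * k + 2)) :
    IsMooreLike H (d + 1) (2 * k + 2) := by
  rw [mooreBound_of_even] at hcard
  have hS : 0 < ∑ i ∈ Finset.range k, d ^ i :=
    Finset.sum_pos (fun i _ => by positivity) (by simp; omega)
  have hfar {x w} (hxw : H.Adj x w) (p : (H.deleteEdges {s(x, w)}).Walk x w) :
      2 * k < p.length := by
    have := length_of_walk_deleteEdges hH hxw p
    omega
  have hball {x w} (hxw : H.Adj x w) :=
    le_ncard_ballSet_union_deleteEdges hH (k := k) (by omega) hdeg hxw (hfar hxw)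
  have hreg : ∀ v, ndeg H v = d + 1 := by
    intro v
    refine le_antisymm ?_ (hdeg v)
    obtain ⟨w, hw⟩ := exists_adj_of_ndeg_pos (H := H) (v := v) (by have := hdeg v; omega)
    have h1 := (hball hw).trans (Set.ncard_le_card _)
    rw [hcard] at h1
    have h2 := Nat.le_of_mul_le_mul_right (Nat.le_of_add_le_add_left h1) hS
    have := hdeg w
    omega
  have hcover {x w} (hxw : H.Adj x w) (y : V) : y ∈ ballSet (H.deleteEdges {s(x, w)}) x k ∨
      y ∈ ballSet (H.deleteEdges {s(x, w)}) w k := by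
    have h1 : ballSet (H.deleteEdges {s(x, w)}) x k ∪ ballSet (H.deleteEdges {s(x, w)}) w k
        = Set.univ := by
      rw [Set.eq_univ_iff_ncard]
      refine le_antisymm (Set.ncard_le_card _) ?_
      have := hball hxw
      rwa [hreg, hreg, Nat.add_sub_cancel, ← hcard] at this
    exact (Set.ext_iff.1 h1 y).2 trivial
  refine ⟨hreg, fun u v => ?_, fun x w hxw => ?_⟩
  · obtain ⟨w, hw⟩ := exists_adj_of_ndeg_pos (H := H) (v := v) (by have := hdeg v; omega)
    have hle := H.deleteEdges_le {s(v, w)}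
    rw [show (2 * k + 2) / 2 = k + 1 by omega]
    rcases hcover hw u with ⟨h, h'⟩ | ⟨h, h'⟩
    · exact (h.dist_anti hle).trans (by omega)
    · obtain ⟨p, hp⟩ := h.exists_walk_length_eq_dist
      have := SimpleGraph.dist_le ((p.mapLe hle).concat hw.symm)
      simp only [Walk.length_concat, Walk.length_map] at this
      omega
  · set K := H.deleteEdges {s(x, w)} with hK
    have hKg : ((2 * k + 2 : ℕ) : ℕ∞) ≤ K.egirth := hH.trans (egirth_anti (H.deleteEdges_le _))
    by_contra! hno
    have hlong : ∀ p : K.Walk x w, 2 * k + 2 ≤ p.length := by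
      intro p
      have := length_of_walk_deleteEdges hH hxw p
      have := hno p
      omega
    obtain ⟨y, hy, hmax⟩ := (Set.toFinite (ballSet K x k)).exists_maximalFor (K.dist · x) _
      ⟨x, .rfl, by simp⟩
    have hyw : y ≠ w := by
      rintro rfl
      obtain ⟨p, hp⟩ := hy.1.exists_walk_length_eq_dist
      have h1 := hlong p.reverse
      have := hy.2
      simp only [Walk.length_reverse] at h1
      omega
    have hdegy : 2 ≤ ndeg K y := by
      by_cases hyx : y = x
      · rw [hyx, hK, ndeg_deleteEdges_left hxw, hreg]
        omega
      · rw [hK, ndeg_deleteEdges_of_ne hyx hyw, hreg]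
        omega
    have hnear : ∀ z, K.Adj y z → z ∈ ballSet K x k := by
      intro z hz
      rcases hcover hxw z with h | ⟨h, h'⟩
      · exact h
      · obtain ⟨p, hp⟩ := hy.1.exists_walk_length_eq_dist
        obtain ⟨q, hq⟩ := h.exists_walk_length_eq_dist
        have h1 := hlong (p.reverse.append (q.cons hz))
        have := hy.2
        simp only [Walk.length_append, Walk.length_reverse, Walk.length_cons] at h1
        omega
    have hnear' : ∀ z, K.Adj y z → K.dist z x ≤ K.dist y x := by
      intro z hz
      rcases le_total (K.dist z x) (K.dist y x) with h | h
      · exact h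
      · exact hmax (hnear z hz) h
    obtain ⟨p, hp⟩ := hy.1.exists_walk_length_eq_dist
    cases p with
    | nil =>
      obtain ⟨z, hz⟩ := exists_adj_of_ndeg_pos (H := K) (v := x) (by omega)
      have h1 := hnear' z hz
      simp only [SimpleGraph.dist_self, Nat.le_zero] at h1
      exact hz.ne' ((hz.symm.reachable.dist_eq_zero_iff).1 h1)
    | @cons _ z₀ _ h₀ p =>
      obtain ⟨z, hz, hne⟩ := Set.exists_ne_of_one_lt_ncard (s := K.neighborSet y) hdegy z₀
      have h1 := le_dist_add_dist_of_adj hKg hy.1 hz h₀ hne (hnear' z hz) (hnear' z₀ h₀)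
      have h2 := hnear' z hz
      have h3 := SimpleGraph.dist_le p
      have h4 := hy.2
      simp only [Walk.length_cons] at hp
      omega

lemma isMooreLike {V : Type*} [Finite V] {H : SimpleGraph V} {δ g : ℕ} (hg : 3 ≤ g) (hδ : 3 ≤ δ)
    (hH : (g : ℕ∞) ≤ H.egirth) (hdeg : ∀ v, δ ≤ ndeg H v)
    (hcard : Nat.card V = mooreBound δ g) : IsMooreLike H δ g := by
  obtain ⟨d, rfl⟩ : ∃ d, δ = d + 1 := ⟨δ - 1, by omega⟩
  rcases Nat.even_or_odd' g with ⟨m, rfl | rfl⟩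
  · obtain ⟨k, rfl⟩ : ∃ k, m = k + 1 := ⟨m - 1, by omega⟩
    exact isMooreLike_even (by omega) (by omega) hH hdeg hcard
  · exact isMooreLike_odd (by omega) (by omega) hH hdeg hcard

lemma coe_le_egirth {V : Type*} {H : SimpleGraph V} {g : ℕ} (hg : H.girth = g) :
    (g : ℕ∞) ≤ H.egirth := by
  rw [le_egirth]
  intro a c hc
  exact_mod_cast hg ▸ girth_le_length hc

/-- An edge lying on a shortest cycle whose deletion leaves some shortest cycle intact. -/
lemma IsMooreLike.exists_edge {V : Type*} {H : SimpleGraph V} {δ g : ℕ} (hg : 3 ≤ g) (hδ : 3 ≤ δ)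
    (hM : IsMooreLike H δ g) (hgirth : H.girth = g) :
    ∃ x w, H.Adj x w ∧ (∃ p : (H.deleteEdges {s(x, w)}).Walk x w, p.length + 1 = g) ∧
      ∃ v, ∃ c : (H.deleteEdges {s(x, w)}).Walk v v, c.IsCycle ∧ c.length = g := by
  have hac : ¬ H.IsAcyclic := by
    rw [← girth_eq_zero]
    omega
  obtain ⟨v, c, hc, hl⟩ := exists_girth_eq_length.2 hac
  cases c with
  | nil => exact absurd rfl hc.ne_nil
  | @cons _ b _ h p =>
    have h3 : ¬ (H.neighborSet v ⊆ {b, p.penultimate}) := by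
      intro hsub
      have h1 := Set.ncard_le_ncard hsub
      have h2 : ndeg H v ≤ 2 := h1.trans ((Set.ncard_insert_le _ _).trans (by simp))
      have := hM.regular v
      omega
    obtain ⟨w, hw, hne⟩ := Set.not_subset.1 h3
    simp only [Set.mem_insert_iff, Set.mem_singleton_iff, not_or] at hne
    refine ⟨v, w, hw, hM.detour v w hw, v, ?_⟩
    have hmem : s(v, w) ∉ (Walk.cons h p).edges := by
      rw [Walk.edges_cons, List.mem_cons, not_or]
      refine ⟨by simp [hne.1, h.ne], fun he => hne.2 ?_⟩
      exact ((Walk.cons_isCycle_iff _ _).1 hc).1.eq_penultimate_of_mem_edges (Sym2.eq_swap ▸ he)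
    have htr : ∀ e ∈ (Walk.cons h p).edges, e ∈ (H.deleteEdges {s(v, w)}).edgeSet := by
      intro e he
      rw [edgeSet_deleteEdges]
      exact ⟨Walk.edges_subset_edgeSet _ he, fun h => hmem (h ▸ he)⟩
    exact ⟨(Walk.cons h p).transfer _ htr, hc.transfer htr, by
      rw [Walk.length_transfer, ← hl, hgirth]⟩

lemma cycleDist_eq_natAbs {q : ℕ} [NeZero q] (i j : ZMod q) :
    cycleDist i j = (i - j).valMinAbs.natAbs := by
  rw [cycleDist, ZMod.valMinAbs_natAbs_eq_min, ← neg_sub i j, ZMod.neg_val]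
  split_ifs with h <;> simp [h]

lemma cycleDist_comm {q : ℕ} (i j : ZMod q) : cycleDist i j = cycleDist j i := min_comm _ _

lemma cycleDist_triangle {q : ℕ} [NeZero q] (i j k : ZMod q) :
    cycleDist i k ≤ cycleDist i j + cycleDist j k := by
  simp only [cycleDist_eq_natAbs]
  rw [← sub_add_sub_cancel i j k]
  exact (ZMod.natAbs_valMinAbs_add_le _ _).trans (Int.natAbs_add_le _ _)

lemma cycleDist_natCast_le {q m n : ℕ} (h : m ≤ n) :
    cycleDist (m : ZMod q) n ≤ n - m := by
  refine (min_le_right _ _).trans ?_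
  rw [← Nat.cast_sub h, ZMod.val_natCast]
  exact Nat.mod_le _ _

lemma cycleDist_natCast {q m n : ℕ} [NeZero q] (h : m ≤ n) (hq : n - m < q) :
    cycleDist (m : ZMod q) n = min (n - m) (q - (n - m)) := by
  rw [cycleDist_comm, cycleDist_eq_natAbs, ZMod.valMinAbs_natAbs_eq_min, ← Nat.cast_sub h,
    ZMod.val_natCast_of_lt hq]

lemma cycleDist_le_length {V : Type*} {G : SimpleGraph V} {q : ℕ} [NeZero q] {f : V → ZMod q}
    (hf : ∀ a b, G.Adj a b → cycleDist (f a) (f b) ≤ 1) {a b : V} (p : G.Walk a b) :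
    cycleDist (f a) (f b) ≤ p.length := by
  induction p with
  | nil => simp [cycleDist]
  | @cons u v _ h p ih =>
    have := hf _ _ h
    rw [Walk.length_cons]
    exact (cycleDist_triangle _ (f v) _).trans (by omega)

lemma ZMod.val_add_one_of_ne_neg_one {n : ℕ} [NeZero n] {s : ZMod n} (h : s ≠ -1) :
    (s + 1).val = s.val + 1 := by
  have h1 : s.val + 1 ≠ n := by
    intro h2
    apply h
    have h3 : ((s.val + 1 : ℕ) : ZMod n) = 0 := by rw [h2, ZMod.natCast_self]
    rw [Nat.cast_add, ZMod.natCast_zmod_val, Nat.cast_one] at h3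
    exact eq_neg_of_add_eq_zero_left h3
  have h2 := s.val_lt
  have h3 : s + 1 = ((s.val + 1 : ℕ) : ZMod n) := by
    rw [Nat.cast_add, ZMod.natCast_zmod_val, Nat.cast_one]
  rw [h3, ZMod.val_natCast_of_lt (by omega)]

lemma ZMod.val_neg_one_add_one {n : ℕ} [NeZero n] : (-1 : ZMod n).val + 1 = n := by
  obtain ⟨m, rfl⟩ := Nat.exists_eq_succ_of_ne_zero (NeZero.ne n)
  rw [ZMod.val_neg_one]

/-- The necklace: `j` copies of `K` arranged cyclically, the vertex `w` of each copy being joined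
to the vertex `x` of the next one. -/
def necklace {W : Type*} (K : SimpleGraph W) (x w : W) (j : ℕ) : SimpleGraph (W × ZMod j) :=
  SimpleGraph.fromRel fun a b =>
    (a.2 = b.2 ∧ K.Adj a.1 b.1) ∨ (a.1 = w ∧ b.1 = x ∧ b.2 = a.2 + 1)

section Necklace

variable {W : Type*} {K : SimpleGraph W} {x w : W} {j : ℕ}

lemma necklace_adj (hxw : x ≠ w) {a b : W × ZMod j} : (necklace K x w j).Adj a b ↔
    (a.2 = b.2 ∧ K.Adj a.1 b.1) ∨ (a.1 = w ∧ b.1 = x ∧ b.2 = a.2 + 1) ∨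
      (b.1 = w ∧ a.1 = x ∧ a.2 = b.2 + 1) := by
  rw [necklace, fromRel_adj]
  constructor
  · rintro ⟨-, (⟨h, h'⟩ | h) | (⟨h, h'⟩ | h)⟩
    exacts [.inl ⟨h, h'⟩, .inr (.inl h), .inl ⟨h.symm, h'.symm⟩, .inr (.inr h)]
  · rintro (⟨h, h'⟩ | h | h)
    · exact ⟨fun e => h'.ne (e ▸ rfl), .inl (.inl ⟨h, h'⟩)⟩
    · refine ⟨?_, .inl (.inr h)⟩
      rintro rfl
      exact hxw (h.2.1.symm.trans h.1)
    · refine ⟨?_, .inr (.inr h)⟩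
      rintro rfl
      exact hxw (h.2.1.symm.trans h.1)

/-- The inclusion of a copy of `K` into the necklace. -/
def necklaceInclusion (K : SimpleGraph W) {x w : W} (hxw : x ≠ w) (s : ZMod j) :
    K →g necklace K x w j where
  toFun a := (a, s)
  map_rel' h := (necklace_adj hxw).2 (.inl ⟨rfl, h⟩)

lemma necklaceInclusion_injective (hxw : x ≠ w) (s : ZMod j) :
    Function.Injective (necklaceInclusion K hxw s) :=
  fun _ _ h => congrArg Prod.fst h

lemma necklace_adj_bridge (hxw : x ≠ w) (s : ZMod j) :
    (necklace K x w j).Adj (w, s) (x, s + 1) :=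
  (necklace_adj hxw).2 (.inr (.inl ⟨rfl, rfl, rfl⟩))

lemma necklace_dist_le (hxw : x ≠ w) (hK : K.Connected) (a b : W) (s : ZMod j) :
    (necklace K x w j).dist (a, s) (b, s) ≤ K.dist a b := by
  obtain ⟨p, hp⟩ := hK.exists_walk_length_eq_dist a b
  rw [← hp, ← p.length_map (necklaceInclusion K hxw s)]
  exact dist_le (p.map (necklaceInclusion K hxw s))

lemma necklace_connected [NeZero j] (hxw : x ≠ w) (hK : K.Connected) :
    (necklace K x w j).Connected := by
  have h1 (a b : W) (s : ZMod j) : (necklace K x w j).Reachable (a, s) (b, s) :=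
    (hK.preconnected a b).map (necklaceInclusion K hxw s)
  have h2 (n : ℕ) : (necklace K x w j).Reachable (x, 0) (x, (n : ZMod j)) := by
    induction n with
    | zero => simp
    | succ n ih =>
      push_cast
      exact (ih.trans (h1 x w _)).trans (necklace_adj_bridge hxw _).reachable
  have h3 (a : W × ZMod j) : (necklace K x w j).Reachable (x, 0) a := by
    have := h2 a.2.val
    rw [ZMod.natCast_zmod_val] at this
    exact this.trans (h1 x a.1 _)
  have : Nonempty (W × ZMod j) := ⟨(x, 0)⟩
  exact ⟨fun a b => (h3 a).symm.trans (h3 b)⟩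

/-- Position along the necklace, counted from the copy `base`. -/
noncomputable def necklacePos (K : SimpleGraph W) (x : W) (g : ℕ) (base : ZMod j)
    (a : W × ZMod j) : ℕ :=
  g * (a.2 - base).val + min (K.dist x a.1) (g - 1)

lemma necklacePos_adj [NeZero j] {g : ℕ} (hxw : x ≠ w) (hK : K.Connected)
    (hd : K.dist x w + 1 = g) (base : ZMod j) {a b : W × ZMod j}
    (h : (necklace K x w j).Adj a b) :
    (necklacePos K x g base a ≤ necklacePos K x g base b + 1 ∧
      necklacePos K x g base b ≤ necklacePos K x g base a + 1) ∨
    (a = (w, base - 1) ∧ b = (x, base)) ∨ (b = (w, base - 1) ∧ a = (x, base)) := by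
  have key (s : ZMod j) (hs : s ≠ base - 1) :
      necklacePos K x g base (x, s + 1) = necklacePos K x g base (w, s) + 1 := by
    simp only [necklacePos]
    rw [show s + 1 - base = (s - base) + 1 by ring, ZMod.val_add_one_of_ne_neg_one, mul_add]
    · simp only [SimpleGraph.dist_self]
      omega
    · intro h
      exact hs (by linear_combination h)
  obtain ⟨a, s⟩ := a
  obtain ⟨b, t⟩ := b
  rcases (necklace_adj hxw).1 h with ⟨h, h'⟩ | ⟨h, h', h''⟩ | ⟨h, h', h''⟩
  · left
    dsimp only at h h'
    subst h
    have h1 := dist_le_succ_of_adj (x := x) h' (hK.preconnected _ _)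
    have h2 := dist_le_succ_of_adj (x := x) h'.symm (hK.preconnected _ _)
    simp only [necklacePos, SimpleGraph.dist_comm (u := x)]
    omega
  · dsimp only at h h' h''
    subst h h' h''
    by_cases hs : s = base - 1
    · exact .inr (.inl (by simp [hs]))
    · left
      rw [key s hs]
      omega
  · dsimp only at h h' h''
    subst h h' h''
    by_cases hs : t = base - 1
    · exact .inr (.inr (by simp [hs]))
    · left
      rw [key t hs]
      omega

lemma necklacePos_start {g : ℕ} (base : ZMod j) : necklacePos K x g base (x, base) = 0 := by
  simp [necklacePos]

lemma necklacePos_end [NeZero j] {g : ℕ} (hd : K.dist x w + 1 = g) (base : ZMod j) :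
    necklacePos K x g base (w, base - 1) + 1 = j * g := by
  have h : (base - 1 - base : ZMod j) = -1 := by ring
  have h1 := ZMod.val_neg_one_add_one (n := j)
  simp only [necklacePos, h]
  conv_rhs => rw [← h1]
  rw [add_mul, one_mul, mul_comm]
  omega

lemma cycleDist_necklacePos_le_dist [NeZero j] {g : ℕ} (hxw : x ≠ w)
    (hK : K.Connected) (hd : K.dist x w + 1 = g) (a b : W × ZMod j) :
    cycleDist (necklacePos K x g 0 a : ZMod (j * g)) (necklacePos K x g 0 b) ≤
      (necklace K x w j).dist a b := by
  have : NeZero g := ⟨by omega⟩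
  obtain ⟨p, hp⟩ := (necklace_connected (j := j) hxw hK).exists_walk_length_eq_dist a b
  rw [← hp]
  refine cycleDist_le_length (f := fun a => (necklacePos K x g 0 a : ZMod (j * g))) ?_ p
  intro a b hab
  have wrap : cycleDist (necklacePos K x g 0 (w, (0 : ZMod j) - 1) : ZMod (j * g))
      (necklacePos K x g 0 (x, (0 : ZMod j))) ≤ 1 := by
    have h1 := necklacePos_end (j := j) hd 0
    have h2 := cycleDist_natCast_le (q := j * g)
      (Nat.le_succ (necklacePos K x g 0 (w, (0 : ZMod j) - 1)))
    rw [Nat.succ_eq_add_one, h1, ZMod.natCast_self] at h2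
    rw [necklacePos_start, Nat.cast_zero]
    omega
  rcases necklacePos_adj hxw hK hd 0 hab with ⟨h1, h2⟩ | ⟨rfl, rfl⟩ | ⟨rfl, rfl⟩
  · rcases le_total (necklacePos K x g 0 a) (necklacePos K x g 0 b) with h | h
    · exact (cycleDist_natCast_le h).trans (by omega)
    · rw [cycleDist_comm]
      exact (cycleDist_natCast_le h).trans (by omega)
  · exact wrap
  · rw [cycleDist_comm]
    exact wrap

lemma necklace_dist_ends {g : ℕ} (hj : 2 ≤ j) (hxw : x ≠ w) (hK : K.Connected)
    (hd : K.dist x w + 1 = g) (s : ZMod j) :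
    (necklace K x w j).dist (x, s) (w, s) = g - 1 := by
  have : NeZero g := ⟨by omega⟩
  have : NeZero j := ⟨by omega⟩
  refine le_antisymm ((necklace_dist_le hxw hK x w s).trans (by omega)) ?_
  refine le_trans ?_ (cycleDist_necklacePos_le_dist hxw hK hd _ _)
  have hjg : 2 * g ≤ j * g := Nat.mul_le_mul_right g hj
  simp only [necklacePos, SimpleGraph.dist_self]
  rw [cycleDist_natCast] <;> omega

lemma necklace_ndeg {W : Type*} [Finite W] {H : SimpleGraph W} {x w : W} {j : ℕ}
    (hxw : H.Adj x w) (a : W × ZMod j) :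
    ndeg (necklace (H.deleteEdges {s(x, w)}) x w j) a = ndeg H a.1 := by
  classical
  obtain ⟨a, s⟩ := a
  let f : W → W × ZMod j := fun b =>
    (b, s + if a = w ∧ b = x then 1 else if a = x ∧ b = w then -1 else 0)
  have hf : Function.Injective f := fun _ _ h => congrArg Prod.fst h
  unfold ndeg
  rw [← Set.ncard_image_of_injective _ hf]
  congr 1
  ext ⟨b, t⟩
  have hne := hxw.ne
  have hadj := hxw.symm
  simp only [mem_neighborSet, necklace_adj hne, deleteEdges_adj, Set.mem_singleton_iff, Sym2.eq_iff,
    Set.mem_image, f, Prod.mk.injEq]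
  by_cases h1 : a = w ∧ b = x
  · obtain ⟨rfl, rfl⟩ := h1
    simp [hne, hne.symm, hadj, eq_comm]
  · by_cases h2 : a = x ∧ b = w
    · obtain ⟨rfl, rfl⟩ := h2
      simp [hne, hne.symm, hxw, eq_comm, ← sub_eq_add_neg]
      rw [eq_sub_iff_add_eq, eq_comm]
    · constructor
      · rintro (⟨h, h', -⟩ | ⟨h, h', -⟩ | ⟨h, h', -⟩)
        exacts [⟨b, h', rfl, by simp [h1, h2, h]⟩, absurd ⟨h, h'⟩ h1, absurd ⟨h', h⟩ h2]
      · rintro ⟨b, h, rfl, h'⟩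
        rw [if_neg h1, if_neg h2, add_zero] at h'
        exact .inl ⟨h', h, by tauto⟩

/-! ### Girth of the necklace -/

lemma necklacePos_le_add_length [NeZero j] {g : ℕ} (hxw : x ≠ w) (hK : K.Connected)
    (hd : K.dist x w + 1 = g) (base : ZMod j) {a b : W × ZMod j} (p : (necklace K x w j).Walk a b)
    (hp : s((w, base - 1), (x, base)) ∉ p.edges) :
    necklacePos K x g base a ≤ necklacePos K x g base b + p.length ∧
      necklacePos K x g base b ≤ necklacePos K x g base a + p.length := by
  induction p with
  | nil => simp
  | cons h p ih =>
    simp only [Walk.edges_cons, List.mem_cons, not_or] at hp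
    have h1 := ih hp.2
    rw [Walk.length_cons]
    rcases necklacePos_adj hxw hK hd base h with h2 | ⟨rfl, rfl⟩ | ⟨rfl, rfl⟩
    · omega
    · exact absurd rfl hp.1
    · exact absurd Sym2.eq_swap hp.1

lemma le_length_of_mem_edges_necklace [NeZero j] {g : ℕ} (hxw : x ≠ w) (hK : K.Connected)
    (hd : K.dist x w + 1 = g) (base : ZMod j) {a b : W × ZMod j} (p : (necklace K x w j).Walk a b)
    (hp : p.IsTrail) (hmem : s((w, base - 1), (x, base)) ∈ p.edges) :
    j * g ≤ p.length + (necklacePos K x g base a - necklacePos K x g base b)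
      + (necklacePos K x g base b - necklacePos K x g base a) := by
  have h0 := necklacePos_start (K := K) (x := x) (g := g) base
  have h1 := necklacePos_end hd base
  induction p with
  | nil => simp at hmem
  | @cons u v _ h p ih =>
    rw [Walk.isTrail_cons] at hp
    rw [Walk.edges_cons, List.mem_cons] at hmem
    rw [Walk.length_cons]
    by_cases he : s((w, base - 1), (x, base)) ∈ p.edges
    · have h2 := ih hp.1 he
      rcases necklacePos_adj hxw hK hd base h with h3 | ⟨rfl, rfl⟩ | ⟨rfl, rfl⟩
      · omega
      · exact absurd he hp.2
      · exact absurd he (Sym2.eq_swap ▸ hp.2)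
    · have h2 := necklacePos_le_add_length hxw hK hd base p he
      rcases Sym2.eq_iff.1 (hmem.resolve_right he) with ⟨rfl, rfl⟩ | ⟨rfl, rfl⟩ <;> omega

/-- A walk of the necklace using no connecting edge projects to a walk of `K`. -/
lemma exists_walk_of_forall_notMem_edges (hxw : x ≠ w) {a b : W × ZMod j}
    (p : (necklace K x w j).Walk a b) (hp : ∀ s, s((w, s - 1), (x, s)) ∉ p.edges) :
    ∃ p' : K.Walk a.1 b.1, p'.support.map (·, a.2) = p.support := by
  induction p with
  | nil => exact ⟨.nil, by simp⟩
  | @cons u v _ h p ih =>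
    obtain ⟨p', hp'⟩ := ih fun s hs => hp s (by simp [hs])
    rcases (necklace_adj hxw).1 h with ⟨h1, h2⟩ | ⟨h1, h2, h3⟩ | ⟨h1, h2, h3⟩
    · exact ⟨.cons h2 p', by simp [h1, hp', Prod.ext_iff]⟩
    · refine absurd ?_ (hp v.2)
      obtain ⟨u, s⟩ := u
      obtain ⟨v, t⟩ := v
      simp_all
    · refine absurd ?_ (hp u.2)
      obtain ⟨u, s⟩ := u
      obtain ⟨v, t⟩ := v
      simp_all

lemma le_egirth_necklace [NeZero j] {g : ℕ} (hxw : x ≠ w) (hK : K.Connected)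
    (hd : K.dist x w + 1 = g) (hg : (g : ℕ∞) ≤ K.egirth) :
    (g : ℕ∞) ≤ (necklace K x w j).egirth := by
  rw [le_egirth]
  intro a c hc
  by_cases hs : ∃ s, s((w, s - 1), (x, s)) ∈ c.edges
  · obtain ⟨s, hs⟩ := hs
    have h1 := le_length_of_mem_edges_necklace hxw hK hd s c hc.isTrail hs
    have h2 : g ≤ j * g := Nat.le_mul_of_pos_left g (NeZero.pos j)
    exact_mod_cast (by omega : g ≤ c.length)
  · push Not at hs
    obtain ⟨c', hc'⟩ := exists_walk_of_forall_notMem_edges hxw c hs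
    have hlen : c'.length = c.length := by
      have := congrArg List.length hc'
      simpa using this
    rw [← hlen]
    refine le_egirth.1 hg _ c' ?_
    rw [Walk.isCycle_iff_isPath_tail_and_le_length]
    have h3 := hc.three_le_length
    refine ⟨?_, by omega⟩
    rw [Walk.isPath_def, Walk.support_tail_of_not_nil _ (by
      intro h
      have := Walk.length_eq_zero_iff.2 h
      omega)]
    refine List.Nodup.of_map (·, a.2) ?_
    rw [List.map_tail, hc']
    exact hc.support_nodup

/-! ### A long isometric cycle of the necklace -/

/-- The cyclic sequence running through all copies of `K` along the walk `p`. -/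
def necklaceSeq (j : ℕ) (p : K.Walk x w) (g n : ℕ) : W × ZMod j :=
  (p.getVert (n % g), ((n / g : ℕ) : ZMod j))

lemma necklaceSeq_mod (p : K.Walk x w) (g n : ℕ) :
    necklaceSeq j p g (n % (j * g)) = necklaceSeq j p g n := by
  unfold necklaceSeq
  rw [Nat.mod_mul_left_mod, mul_comm, Nat.mod_mul_right_div_self, ZMod.natCast_mod]

lemma necklaceSeq_adj (hxw : x ≠ w) {p : K.Walk x w} {g : ℕ} (hp : p.length + 1 = g) (n : ℕ) :
    (necklace K x w j).Adj (necklaceSeq j p g n) (necklaceSeq j p g (n + 1)) := by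
  have hlt := Nat.mod_lt n (by omega : g > 0)
  have hn := Nat.div_add_mod n g
  rw [necklace_adj hxw]
  simp only [necklaceSeq]
  by_cases h : n % g + 1 < g
  · left
    have h1 : (n + 1) / g = n / g ∧ (n + 1) % g = n % g + 1 :=
      (Nat.div_mod_unique (by omega)).2 ⟨by omega, h⟩
    rw [h1.1, h1.2]
    exact ⟨rfl, p.adj_getVert_succ (by omega)⟩
  · right; left
    have h1 : (n + 1) / g = n / g + 1 ∧ (n + 1) % g = 0 :=
      (Nat.div_mod_unique (by omega)).2 ⟨by rw [mul_add]; omega, by omega⟩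
    rw [h1.1, h1.2, show n % g = p.length by omega]
    simp

lemma hasIsoCycle_necklace [NeZero j] {g : ℕ} (hxw : x ≠ w) (hK : K.Connected)
    (hd : K.dist x w + 1 = g) (hjg : 3 ≤ j * g) : HasIsoCycle (necklace K x w j) (j * g) := by
  have : NeZero g := ⟨by omega⟩
  obtain ⟨p, hp⟩ := hK.exists_walk_length_eq_dist x w
  have hN := necklace_connected (j := j) hxw hK
  let F : ZMod (j * g) → W × ZMod j := fun i => necklaceSeq j p g i.val
  have hF (n : ℕ) : F n = necklaceSeq j p g n := by
    simp only [F, ZMod.val_natCast, necklaceSeq_mod]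
  have hstep (i : ZMod (j * g)) (n : ℕ) : (necklace K x w j).dist (F i) (F (i + n)) ≤ n := by
    induction n with
    | zero => simp
    | succ n ih =>
      have h1 : (necklace K x w j).Adj (F (i + n)) (F (i + (n + 1 : ℕ))) := by
        have h2 := necklaceSeq_adj (j := j) hxw (p := p) (g := g) (by omega) (i.val + n)
        rw [← hF, ← hF] at h2
        push_cast at h2 ⊢
        simpa [add_assoc] using h2
      have h3 := hN.dist_triangle (u := F i) (v := F (i + n)) (w := F (i + (n + 1 : ℕ)))
      rw [dist_eq_one_iff_adj.2 h1] at h3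
      omega
  have hpos (i : ZMod (j * g)) : (necklacePos K x g 0 (F i) : ZMod (j * g)) = i := by
    have h1 : necklacePos K x g 0 (F i) = i.val := by
      have hlt := Nat.mod_lt i.val (by omega : g > 0)
      have hdiv : i.val / g < j := Nat.div_lt_of_lt_mul (mul_comm j g ▸ i.val_lt)
      have h2 : K.dist x (p.getVert (i.val % g)) = i.val % g := by
        have h3 := SimpleGraph.dist_le (p.take (i.val % g))
        have h4 := SimpleGraph.dist_le (p.drop (i.val % g))
        have h5 := hK.dist_triangle (u := x) (v := p.getVert (i.val % g)) (w := w)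
        simp only [Walk.take_length, Walk.drop_length] at h3 h4
        omega
      simp only [necklacePos, F, necklaceSeq, sub_zero, ZMod.val_natCast_of_lt hdiv, h2]
      rw [min_eq_left (by omega), Nat.div_add_mod]
    rw [h1, ZMod.natCast_zmod_val]
  have hle (i i' : ZMod (j * g)) : (necklace K x w j).dist (F i) (F i') ≤ (i' - i).val := by
    have := hstep i (i' - i).val
    rwa [ZMod.natCast_zmod_val, add_sub_cancel] at this
  refine ⟨F, hjg, fun i k => le_antisymm (le_min ?_ (hle i k)) ?_⟩
  · rw [SimpleGraph.dist_comm]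
    exact hle k i
  · simpa only [hpos] using cycleDist_necklacePos_le_dist hxw hK hd (F i) (F k)

/-! ### No longer isometric cycle of the necklace -/

lemma exists_le_and_lt_succ {lev : ℕ → ℕ} {t m n : ℕ} (hmn : m ≤ n) (hm : lev m ≤ t)
    (hn : t < lev n) : ∃ k, m ≤ k ∧ k < n ∧ lev k ≤ t ∧ t < lev (k + 1) := by
  induction n, hmn using Nat.le_induction with
  | base => omega
  | succ n hmn ih =>
    by_cases h : t < lev n
    · obtain ⟨k, hk⟩ := ih h
      exact ⟨k, hk.1, by omega, hk.2.2⟩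
    · exact ⟨n, hmn, by omega, by omega, hn⟩

/-- An isometric cycle of the necklace through a connecting edge has length at most `j * g`: it
has to leave every copy of `K` through the vertex `w`. -/
lemma le_of_isometric_seq {g q : ℕ} (hj : 2 ≤ j) (hg : 3 ≤ g) (hxw : x ≠ w) (hK : K.Connected)
    (hd : K.dist x w + 1 = g) (hq : 3 ≤ q) {h : ℕ → W × ZMod j} {base : ZMod j}
    (h0 : h 0 = (x, base)) (hend : h (q - 1) = (w, base - 1))
    (hdist : ∀ m m', m ≤ m' → m' < q →
      (necklace K x w j).dist (h m) (h m') = min (m' - m) (q - (m' - m))) : q ≤ j * g := by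
  have : NeZero j := ⟨by omega⟩
  by_contra! hlt
  have hinj (m m' : ℕ) (hm : m ≤ m') (hm' : m' < q) (he : h m = h m') : m = m' := by
    have := hdist m m' hm hm'
    rw [he, SimpleGraph.dist_self] at this
    omega
  let lev (m : ℕ) : ℕ := ((h m).2 - base).val
  have hlev (s : ZMod j) (hs : s ≠ base - 1) : (s + 1 - base).val = (s - base).val + 1 := by
    rw [show s + 1 - base = (s - base) + 1 by ring, ZMod.val_add_one_of_ne_neg_one]
    intro h
    exact hs (by linear_combination h)
  have hstep (m : ℕ) (hm : m + 1 < q) : lev (m + 1) ≤ lev m ∨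
      (lev (m + 1) = lev m + 1 ∧ (h m).1 = w ∧ (h (m + 1)).1 = x ∧
        (h (m + 1)).2 = (h m).2 + 1) := by
    have hadj : (necklace K x w j).Adj (h m) (h (m + 1)) := by
      rw [← dist_eq_one_iff_adj, hdist m (m + 1) (by omega) hm]
      omega
    rcases (necklace_adj hxw).1 hadj with ⟨h1, -⟩ | ⟨h1, h2, h3⟩ | ⟨h1, h2, h3⟩
    · exact .inl (by simp only [lev, h1, le_refl])
    · right
      refine ⟨?_, h1, h2, h3⟩
      simp only [lev, h3]
      refine hlev _ fun h4 => ?_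
      have := hinj m (q - 1) (by omega) (by omega) (hend ▸ Prod.ext h1 h4)
      omega
    · left
      by_cases h4 : (h (m + 1)).2 = base - 1
      · have h5 := hinj (m + 1) (q - 1) (by omega) (by omega) (hend ▸ Prod.ext h1 h4)
        have h6 := hinj 0 m (by omega) (by omega)
          (h0 ▸ (Prod.ext h2 (by rw [h3, h4, sub_add_cancel])).symm)
        omega
      · simp only [lev, h3, hlev _ h4]
        omega
  have hlast : lev (q - 1) + 1 = j := by
    simp only [lev, hend]
    rw [show base - 1 - base = -1 by ring]
    exact ZMod.val_neg_one_add_one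
  have hexit (t m : ℕ) (ht : t < j) (hm : m < q) (hx : h m = (x, base + t)) :
      ∃ m', m ≤ m' ∧ m' < q ∧ h m' = (w, base + t) ∧
        (t + 1 < j → m' + 1 < q ∧ h (m' + 1) = (x, base + (t + 1 : ℕ))) ∧
        (t + 1 = j → m' = q - 1) := by
    have hlm : lev m = t := by
      simp only [lev, hx, add_sub_cancel_left, ZMod.val_natCast_of_lt ht]
    by_cases htj : t + 1 < j
    · obtain ⟨k, hk1, hk2, hk3, hk4⟩ := exists_le_and_lt_succ (lev := lev) (t := t)
        (by omega : m ≤ q - 1) (by omega) (by omega)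
      rcases hstep k (by omega) with h1 | ⟨h1, h2, h3, h4⟩
      · omega
      · have h5 : (h k).2 = base + t := by
          have h6 : lev k = t := by omega
          rw [← h6]
          simp only [lev, ZMod.natCast_zmod_val, add_sub_cancel]
        refine ⟨k, hk1, by omega, Prod.ext h2 h5, fun _ => ⟨by omega, Prod.ext h3 ?_⟩, by omega⟩
        rw [h4, h5]
        push_cast
        ring
    · refine ⟨q - 1, by omega, by omega, ?_, by omega, fun _ => rfl⟩
      have h1 : ((t + 1 : ℕ) : ZMod j) = 0 := by rw [show t + 1 = j by omega, ZMod.natCast_self]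
      push_cast at h1
      rw [hend]
      exact Prod.ext rfl (by linear_combination -h1)
  have hjg : 2 * g ≤ j * g := Nat.mul_le_mul_right g hj
  have hlen (t m m' : ℕ) (hm : m ≤ m') (hm' : m' < q) (hx : h m = (x, base + t))
      (hw : h m' = (w, base + t)) : m' - m = g - 1 ∨ q - (m' - m) = g - 1 := by
    have h1 := hdist m m' hm hm'
    rw [hx, hw, necklace_dist_ends hj hxw hK hd] at h1
    omega
  have hmain (t : ℕ) (ht : t < j) : t * g < q ∧ h (t * g) = (x, base + t) := by
    induction t with
    | zero => exact ⟨by omega, by simp [h0]⟩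
    | succ t ih =>
      obtain ⟨ih1, ih2⟩ := ih (by omega)
      obtain ⟨m, hm1, hm2, hm3, hm4, -⟩ := hexit t (t * g) (by omega) ih1 ih2
      obtain ⟨hm5, hm6⟩ := hm4 ht
      rcases hlen t _ _ hm1 hm2 ih2 hm3 with h1 | h1
      · rw [add_mul, one_mul, show t * g + g = m + 1 by omega]
        exact ⟨hm5, hm6⟩
      · obtain ⟨m', hn1, hn2, hn3, -⟩ := hexit (t + 1) (m + 1) ht hm5 hm6
        have := hlen (t + 1) _ _ hn1 hn2 hm6 hn3
        omega
  obtain ⟨h1, h2⟩ := hmain (j - 1) (by omega)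
  obtain ⟨m, hm1, hm2, hm3, -, hm4⟩ := hexit (j - 1) _ (by omega) h1 h2
  have hm5 := hm4 (by omega)
  have h3 : (j - 1) * g + g = j * g := by
    rw [← Nat.succ_mul, Nat.succ_eq_add_one, Nat.sub_add_cancel (by omega)]
  rcases hlen (j - 1) _ _ hm1 hm2 h2 hm3 with h4 | h4 <;> omega

lemma le_of_hasIsoCycle_necklace {g q : ℕ} (hj : 3 ≤ j) (hg : 3 ≤ g) (hxw : x ≠ w)
    (hK : K.Connected) (hd : K.dist x w + 1 = g)
    (hdiam : ∀ a b, K.dist a b ≤ g / 2 + (g - 2)) (hq : HasIsoCycle (necklace K x w j) q) :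
    q ≤ j * g := by
  obtain ⟨f, hq3, hf⟩ := hq
  have : NeZero q := ⟨by omega⟩
  have : Fact (1 < q) := ⟨by omega⟩
  by_cases hconst : ∀ i, (f (i + 1)).2 = (f i).2
  · have h1 (n : ℕ) : (f n).2 = (f 0).2 := by
      induction n with
      | zero => simp
      | succ n ih => rw [Nat.cast_add, Nat.cast_one, hconst, ih]
    have h2 : (necklace K x w j).dist (f (0 : ℕ)) (f (q / 2 : ℕ)) ≤ g / 2 + (g - 2) := by
      refine le_trans ?_ (hdiam (f (0 : ℕ)).1 (f (q / 2 : ℕ)).1)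
      refine le_trans (le_of_eq ?_) (necklace_dist_le hxw hK _ _ (f 0).2)
      congr 1
      exacts [Prod.ext rfl (h1 _), Prod.ext rfl (h1 _)]
    rw [hf, cycleDist_natCast (Nat.zero_le _) (by omega)] at h2
    have h3 : 3 * g ≤ j * g := Nat.mul_le_mul_right g hj
    omega
  · push Not at hconst
    obtain ⟨i, hi⟩ := hconst
    have hadj : (necklace K x w j).Adj (f i) (f (i + 1)) := by
      rw [← dist_eq_one_iff_adj, hf, cycleDist_eq_natAbs, sub_add_cancel_left,
        ZMod.natAbs_valMinAbs_neg, ZMod.valMinAbs_natAbs_eq_min, ZMod.val_one]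
      omega
    have hneg : ((q - 1 : ℕ) : ZMod q) = -1 := by
      rw [Nat.cast_sub (by omega), ZMod.natCast_self]
      simp
    rcases (necklace_adj hxw).1 hadj with ⟨h1, -⟩ | ⟨h1, h2, h3⟩ | ⟨h1, h2, h3⟩
    · exact absurd h1.symm hi
    · refine le_of_isometric_seq (by omega) hg hxw hK hd hq3 (base := (f (i + 1)).2)
        (h := fun m => f (i + 1 + m)) (by simp [← h2]) ?_ fun m m' hm hm' => ?_
      · simp only [hneg, add_neg_cancel_right]
        exact Prod.ext h1 (eq_sub_of_add_eq h3.symm)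
      · rw [hf, ← cycleDist_natCast hm (by omega)]
        simp [cycleDist]
    · refine le_of_isometric_seq (by omega) hg hxw hK hd hq3 (base := (f i).2)
        (h := fun m => f (i - m)) (by simp [← h2]) ?_ fun m m' hm hm' => ?_
      · simp only [hneg, sub_neg_eq_add]
        exact Prod.ext h1 (eq_sub_of_add_eq h3.symm)
      · rw [hf, ← cycleDist_natCast hm (by omega), cycleDist_comm]
        simp [cycleDist]

end Necklace

/-- Replacing the edge `xw` by a detour of length `g - 1` in a trail. -/
lemma exists_walk_deleteEdges_of_isTrail {W : Type*} {H : SimpleGraph W} {x w : W} {g : ℕ}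
    (d : (H.deleteEdges {s(x, w)}).Walk x w) (hd : d.length + 1 = g) (hg : 2 ≤ g) {a b : W}
    (p : H.Walk a b) (hp : p.IsTrail) :
    ∃ p' : (H.deleteEdges {s(x, w)}).Walk a b, p'.length ≤ p.length + (g - 2) := by
  induction p with
  | nil => exact ⟨.nil, by simp⟩
  | @cons u v _ h p ih =>
    rw [Walk.isTrail_cons] at hp
    by_cases he : s(u, v) = s(x, w)
    · let p' := p.toDeleteEdge s(x, w) (he ▸ hp.2)
      have hp' : p'.length = p.length := Walk.length_transfer ..
      rcases Sym2.eq_iff.1 he with ⟨rfl, rfl⟩ | ⟨rfl, rfl⟩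
      · refine ⟨d.append p', ?_⟩
        rw [Walk.length_append, Walk.length_cons]
        omega
      · refine ⟨d.reverse.append p', ?_⟩
        rw [Walk.length_append, Walk.length_cons, Walk.length_reverse]
        omega
    · obtain ⟨p', hp'⟩ := ih hp.1
      refine ⟨.cons (deleteEdges_adj.2 ⟨h, he⟩) p', ?_⟩
      rw [Walk.length_cons, Walk.length_cons]
      omega

/-- Theorem 4.1: from a Moore graph of girth `g` and minimum degree `δ ≥ 3`, one obtains for
every `j ≥ 3` a `δ`-regular graph with girth `g`, equator `q = j·g` and order `(q/g)·M(δ,g)`. -/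
theorem stmt_4 (j g δ : ℕ) (hj : 3 ≤ j) (hg : 3 ≤ g) (hδ : 3 ≤ δ)
    (hMoore : ∃ (W : Type) (H : SimpleGraph W), Finite W ∧ H.Connected ∧
      H.girth = g ∧ HasMinDegree H δ ∧ Nat.card W = mooreBound δ g) :
    ∃ (W : Type) (H : SimpleGraph W), Finite W ∧ H.Connected ∧
      (∀ v : W, ndeg H v = δ) ∧ H.girth = g ∧ IsEquator H (j * g) ∧
      Nat.card W = j * mooreBound δ g := by
  obtain ⟨W, H, _, hconn, hgirth, ⟨hmin, -⟩, hcard⟩ := hMoore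
  have : NeZero j := ⟨by omega⟩
  have hegirth : (g : ℕ∞) ≤ H.egirth := coe_le_egirth hgirth
  have hM : IsMooreLike H δ g := isMooreLike hg hδ hegirth hmin hcard
  obtain ⟨x, w, hxw, ⟨d, hd⟩, v, c, hc, hcl⟩ := IsMooreLike.exists_edge hg hδ hM hgirth
  have hwalk (a b : W) : ∃ p : (H.deleteEdges {s(x, w)}).Walk a b,
      p.length ≤ g / 2 + (g - 2) := by
    obtain ⟨p, hp, hlen⟩ := hconn.exists_path_of_dist a b
    obtain ⟨p', hp'⟩ := exists_walk_deleteEdges_of_isTrail d hd (by omega) p hp.isTrail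
    have := hM.dist_le a b
    exact ⟨p', by omega⟩
  have : Nonempty W := ⟨x⟩
  have hK : (H.deleteEdges {s(x, w)}).Connected := ⟨fun a b => (hwalk a b).elim fun p _ => ⟨p⟩⟩
  have hdiam (a b : W) : (H.deleteEdges {s(x, w)}).dist a b ≤ g / 2 + (g - 2) :=
    (hwalk a b).elim fun p hp => (dist_le p).trans hp
  have hdist : (H.deleteEdges {s(x, w)}).dist x w + 1 = g := by
    obtain ⟨p, hp⟩ := hK.exists_walk_length_eq_dist x w
    have h1 := length_of_walk_deleteEdges hegirth hxw p
    have h2 := dist_le d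
    omega
  have hegirthN : (g : ℕ∞) ≤ (necklace (H.deleteEdges {s(x, w)}) x w j).egirth :=
    le_egirth_necklace hxw.ne hK hdist (hegirth.trans (egirth_anti (H.deleteEdges_le _)))
  have hjg : 3 * 3 ≤ j * g := Nat.mul_le_mul hj hg
  refine ⟨W × ZMod j, necklace (H.deleteEdges {s(x, w)}) x w j, inferInstance,
    necklace_connected hxw.ne hK, fun a => (necklace_ndeg hxw a).trans (hM.regular _), ?_,
    ⟨.inl (hasIsoCycle_necklace hxw.ne hK hdist (by omega)),
      fun q => le_of_hasIsoCycle_necklace hj hg hxw.ne hK hdist hdiam⟩, ?_⟩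
  · have h1 := egirth_le_length
      (hc.map (necklaceInclusion_injective hxw.ne (0 : ZMod j)))
    rw [Walk.length_map, hcl] at h1
    rw [girth, le_antisymm h1 hegirthN, ENat.toNat_natCast]
  · rw [Nat.card_prod, Nat.card_zmod, hcard, mul_comm]
end
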